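/- arXiv:1305.7242 — 6 statements merged into one kernel-verified Lean document; each statement's English description precedes it below -/
import Mathlib

section
/- For the random walk excited by its recent history with history window N, single threshold M (1 ≤ M ≤ N), and parameters 0 < p0 < p1 < 1, the almost sure limit s(N,M;p0,p1) := lim_{n→∞} X_n/n exists and equals [ (1/(1−p0)) Σ_{j=0}^{M−1} (2j/N − 1) C(N,j) (p0/(1−p0))^j + (1/(1−p1)) (p0/(1−p0))^M Σ_{j=M}^{N} (2j/N − 1) C(N,j) (p1/(1−p1))^{j−M} ] / [ (1/(1−p0)) Σ_{j=0}^{M−1} C(N,j) (p0/(1−p0))^j + (1/(1−p1)) (p0/(1−p0))^M Σ_{j=M}^{N} C(N,j) (p1/(1−p1))^{j−M} ]. -/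
open Filter Finset MeasureTheory Topology

/-- The probability that, for the random walk excited by its recent history with
history window `N`, threshold `M` and parameters `p0 < p1`, the `n`-th increment
agrees with `e n`, given that the previous increments agree with `e`.
Here `e k = true` encodes an increment `+1` (a jump to the right) at time `k`. -/
noncomputable def stepProb1 (N M : ℕ) (p0 p1 : ℝ) (e : ℕ → Bool) (n : ℕ) : ℝ :=
  let q : ℝ :=
    if n < N then p0
    else if M ≤ ((Finset.Ico (n - N) n).filter (fun k => e k = true)).card then p1
    else p0
  if e n then q else 1 - q

/-- The position after `n` steps of the walk whose increments are encoded by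
`ω : ℕ → Bool` (`true` = `+1`, `false` = `-1`), started at `0`. -/
def walkPos (ω : ℕ → Bool) (n : ℕ) : ℤ :=
  ∑ k ∈ Finset.range n, (if ω k then 1 else -1)

/-- The explicit speed formula `s(N,M;p₀,p₁)`. -/
noncomputable def speed1 (N M : ℕ) (p0 p1 : ℝ) : ℝ :=
  ((1 / (1 - p0)) * ∑ j ∈ Finset.range M,
      (2 * (j : ℝ) / N - 1) * (N.choose j) * (p0 / (1 - p0)) ^ j
    + (1 / (1 - p1)) * (p0 / (1 - p0)) ^ M * ∑ j ∈ Finset.Icc M N,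
      (2 * (j : ℝ) / N - 1) * (N.choose j) * (p1 / (1 - p1)) ^ (j - M)) /
  ((1 / (1 - p0)) * ∑ j ∈ Finset.range M,
      ((N.choose j : ℝ)) * (p0 / (1 - p0)) ^ j
    + (1 / (1 - p1)) * (p0 / (1 - p0)) ^ M * ∑ j ∈ Finset.Icc M N,
      ((N.choose j : ℝ)) * (p1 / (1 - p1)) ^ (j - M))

/-- The number of `true` entries of a finite window. -/
def ones {n : ℕ} (w : Fin n → Bool) : ℕ := ∑ i, (w i).toNat

/-- Drop the oldest entry of a window and append `c`. -/
def shiftWindow {n : ℕ} (w : Fin (n + 1) → Bool) (c : Bool) : Fin (n + 1) → Bool :=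
  Fin.snoc (α := fun _ => Bool) (Fin.tail w) c

/-- The window of length `n` of the sequence `ω` starting at time `k`. -/
def window (n : ℕ) (ω : ℕ → Bool) (k : ℕ) : Fin n → Bool := fun i => ω (k + i)

lemma window_succ (n : ℕ) (ω : ℕ → Bool) (k : ℕ) :
    window (n + 1) ω (k + 1) = shiftWindow (window (n + 1) ω k) (ω (k + (n + 1))) := by
  funext i
  refine Fin.lastCases ?_ (fun j => ?_) i
  · simp [window, shiftWindow, add_assoc, add_comm 1]
  · simp [window, shiftWindow, Fin.tail, add_assoc, add_comm 1]

/-- The transition operator of the window process that appends `true` with probability `q k`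
when the window has `k` entries equal to `true`. -/
noncomputable def transOp (n : ℕ) (q : ℕ → ℝ) :
    ((Fin (n + 1) → Bool) → ℝ) →ₗ[ℝ] ((Fin (n + 1) → Bool) → ℝ) where
  toFun h w := q (ones w) * h (shiftWindow w true) + (1 - q (ones w)) * h (shiftWindow w false)
  map_add' h h' := by funext w; simp only [Pi.add_apply]; ring
  map_smul' a h := by
    funext w; simp only [Pi.smul_apply, smul_eq_mul, RingHom.id_apply]; ring

lemma transOp_apply (n : ℕ) (q : ℕ → ℝ) (h : (Fin (n + 1) → Bool) → ℝ)
    (w : Fin (n + 1) → Bool) :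
    transOp n q h w =
      q (ones w) * h (shiftWindow w true) + (1 - q (ones w)) * h (shiftWindow w false) := rfl

lemma sum_window_cons {n : ℕ} (F : (Fin (n + 1) → Bool) → ℝ) :
    ∑ w, F w = ∑ u : Fin n → Bool,
      (F (Fin.cons (α := fun _ => Bool) true u) + F (Fin.cons (α := fun _ => Bool) false u)) := by
  rw [← Equiv.sum_comp (Fin.consEquiv fun _ => Bool), Fintype.sum_prod_type, Fintype.sum_bool,
    ← Finset.sum_add_distrib]
  rfl

lemma sum_window_snoc {n : ℕ} (F : (Fin (n + 1) → Bool) → ℝ) :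
    ∑ w, F w = ∑ u : Fin n → Bool,
      (F (Fin.snoc (α := fun _ => Bool) u true) + F (Fin.snoc (α := fun _ => Bool) u false)) := by
  rw [← Equiv.sum_comp (Fin.snocEquiv fun _ => Bool), Fintype.sum_prod_type, Fintype.sum_bool,
    ← Finset.sum_add_distrib]
  rfl

lemma ones_cons {n : ℕ} (b : Bool) (u : Fin n → Bool) :
    ones (Fin.cons (α := fun _ => Bool) b u) = ones u + b.toNat := by
  simp [ones, Fin.sum_univ_succ, add_comm]

lemma ones_snoc {n : ℕ} (b : Bool) (u : Fin n → Bool) :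
    ones (Fin.snoc (α := fun _ => Bool) u b) = ones u + b.toNat := by
  simp [ones, Fin.sum_univ_castSucc]

/-- A weight depending only on the number of `true` entries and satisfying the balance equation
is invariant for the window process. -/
lemma sum_weight_transOp {n : ℕ} {q f : ℕ → ℝ}
    (hf : ∀ c, f c * q c = f (c + 1) * (1 - q (c + 1))) (h : (Fin (n + 1) → Bool) → ℝ) :
    ∑ w, f (ones w) * transOp n q h w = ∑ w, f (ones w) * h w := by
  rw [sum_window_cons, sum_window_snoc]
  refine Finset.sum_congr rfl fun u _ => ?_
  simp only [transOp_apply, ones_cons, ones_snoc, shiftWindow, Fin.tail_cons, Bool.toNat_true,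
    Bool.toNat_false, add_zero]
  linear_combination (h (Fin.snoc (α := fun _ => Bool) u true)
    - h (Fin.snoc (α := fun _ => Bool) u false)) * hf (ones u)

lemma eq_const_of_transOp_eq_self {n : ℕ} {q : ℕ → ℝ} (hq0 : ∀ c, 0 < q c) (hq1 : ∀ c, q c < 1)
    {h : (Fin (n + 1) → Bool) → ℝ} (hh : transOp n q h = h) (v v' : Fin (n + 1) → Bool) :
    h v = h v' := by
  obtain ⟨w, hw⟩ := Finite.exists_max h
  have step : ∀ u, h u = h w → ∀ c, h (shiftWindow u c) = h w := by
    intro u hu c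
    have e := congrFun hh u
    rw [transOp_apply, hu] at e
    have a := hw (shiftWindow u true)
    have b := hw (shiftWindow u false)
    have := hq0 (ones u)
    have := hq1 (ones u)
    cases c
    · refine le_antisymm b (le_of_not_gt fun hlt => ?_)
      nlinarith
    · refine le_antisymm a (le_of_not_gt fun hlt => ?_)
      nlinarith
  have reach : ∀ v, h v = h w := by
    intro v
    let e : ℕ → Bool := fun k =>
      if hk : k < n + 1 then w ⟨k, hk⟩
      else if hk' : k - (n + 1) < n + 1 then v ⟨k - (n + 1), hk'⟩ else true
    have h1 : window (n + 1) e 0 = w := by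
      funext i
      simp only [window, e, zero_add]
      rw [dif_pos i.2]
    have h2 : window (n + 1) e (n + 1) = v := by
      funext i
      simp only [window, e]
      rw [dif_neg (by omega), dif_pos (by omega)]
      congr 1
      ext
      simp
    have h3 : ∀ k, h (window (n + 1) e k) = h w := by
      intro k
      induction k with
      | zero => rw [h1]
      | succ k ih => rw [window_succ]; exact step _ ih _
    rw [← h2, h3]
  rw [reach v, reach v']

/-- Solvability of the Poisson equation for the window process. -/
lemma exists_poisson {n : ℕ} {q f : ℕ → ℝ} (hq0 : ∀ c, 0 < q c) (hq1 : ∀ c, q c < 1)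
    (hf0 : ∀ c, 0 < f c) (hf : ∀ c, f c * q c = f (c + 1) * (1 - q (c + 1)))
    {φ : (Fin (n + 1) → Bool) → ℝ} (hφ : ∑ w, f (ones w) * φ w = 0) :
    ∃ h, h - transOp n q h = φ := by
  let T : ((Fin (n + 1) → Bool) → ℝ) →ₗ[ℝ] ((Fin (n + 1) → Bool) → ℝ) :=
    LinearMap.id - transOp n q
  let l : Module.Dual ℝ ((Fin (n + 1) → Bool) → ℝ) :=
    ∑ w, f (ones w) • LinearMap.proj w
  have hl : ∀ h, l h = ∑ w, f (ones w) * h w := fun h => by simp [l]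
  have hl0 : l ≠ 0 := by
    intro h0
    have : 0 < l 1 := by
      rw [hl]
      exact Finset.sum_pos (fun w _ => by simpa using hf0 _) Finset.univ_nonempty
    simp [h0] at this
  have hker : Module.finrank ℝ (LinearMap.ker T) ≤ 1 := by
    have hone : T 1 = 0 := by
      funext w
      simp [T, transOp_apply]
    refine finrank_le_one ⟨1, hone⟩ fun h => ⟨h.1 fun _ => true, ?_⟩
    have := sub_eq_zero.1 (LinearMap.mem_ker.1 h.2)
    ext w
    simpa using eq_const_of_transOp_eq_self hq0 hq1 this.symm (fun _ => true) w
  have hle : LinearMap.range T ≤ LinearMap.ker l := by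
    rintro _ ⟨h, rfl⟩
    rw [LinearMap.mem_ker, hl]
    have := sum_weight_transOp hf h
    simp only [T, LinearMap.sub_apply, LinearMap.id_apply, Pi.sub_apply, mul_sub,
      Finset.sum_sub_distrib]
    linarith
  have e1 := LinearMap.finrank_range_add_finrank_ker T
  have e2 := Module.Dual.finrank_ker_add_one_of_ne_zero hl0
  have heq := Submodule.eq_of_le_of_finrank_le hle (by omega)
  have : φ ∈ LinearMap.range T := by
    rw [heq, LinearMap.mem_ker, hl, hφ]
  obtain ⟨h, hh⟩ := this
  exact ⟨h, hh⟩

lemma sum_window_ones {n : ℕ} (F : ℕ → ℝ) :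
    ∑ w : Fin n → Bool, F (ones w) = ∑ k ∈ Finset.range (n + 1), (n.choose k : ℝ) * F k := by
  induction n generalizing F with
  | zero => simp [ones]
  | succ n ih =>
    have e1 := Finset.sum_range_succ' (fun k => ((n + 1).choose k : ℝ) * F k) (n + 1)
    have e2 := Finset.sum_range_succ' (fun k => (n.choose k : ℝ) * F k) (n + 1)
    have e3 := Finset.sum_range_succ (fun k => (n.choose k : ℝ) * F k) (n + 1)
    rw [sum_window_cons, e1]
    simp only [ones_cons, Bool.toNat_true, Bool.toNat_false, add_zero, Finset.sum_add_distrib,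
      ih F, ih fun k => F (k + 1), Nat.choose_succ_succ, Nat.cast_add, add_mul]
    simp only [Nat.choose_succ_self, Nat.cast_zero, zero_mul, add_zero] at e3
    simp only [Nat.choose_zero_right] at e2 ⊢
    linarith

/-- The set of sequences agreeing with `e` before time `n`. -/
def initCylinder (n : ℕ) (e : ℕ → Bool) : Set (ℕ → Bool) := {ω | ∀ k < n, ω k = e k}

lemma measurableSet_initCylinder (n : ℕ) (e : ℕ → Bool) : MeasurableSet (initCylinder n e) := by
  have : initCylinder n e = ⋂ k, ⋂ (_ : k < n), (fun ω : ℕ → Bool => ω k) ⁻¹' {e k} := by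
    ext ω
    simp [initCylinder]
  rw [this]
  exact MeasurableSet.iInter fun k => MeasurableSet.iInter fun _ =>
    measurable_pi_apply k (measurableSet_singleton _)

lemma initCylinder_eq_union (n : ℕ) (e : ℕ → Bool) :
    initCylinder n e = initCylinder (n + 1) (Function.update e n true) ∪
      initCylinder (n + 1) (Function.update e n false) := by
  ext ω
  simp only [initCylinder, Set.mem_ofPred_eq, Set.mem_union]
  have key : ∀ b, (∀ k < n + 1, ω k = Function.update e n b k) ↔
      (∀ k < n, ω k = e k) ∧ ω n = b := by
    intro b
    rw [Nat.forall_lt_succ_right]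
    refine and_congr (forall₂_congr fun k hk => ?_) (by simp)
    rw [Function.update_of_ne hk.ne]
  rw [key, key]
  cases ω n <;> simp

lemma disjoint_initCylinder_update (n : ℕ) (e : ℕ → Bool) :
    Disjoint (initCylinder (n + 1) (Function.update e n true))
      (initCylinder (n + 1) (Function.update e n false)) := by
  refine Set.disjoint_left.2 fun ω h1 h2 => ?_
  have a := h1 n (Nat.lt_succ_self n)
  have b := h2 n (Nat.lt_succ_self n)
  simp_all

lemma setLIntegral_initCylinder (μ : Measure (ℕ → Bool)) {n : ℕ} {G : (ℕ → Bool) → ENNReal}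
    (hG : ∀ ω ω' : ℕ → Bool, (∀ k < n, ω k = ω' k) → G ω = G ω') (e : ℕ → Bool) :
    ∫⁻ ω in initCylinder n e, G ω ∂μ = G e * μ (initCylinder n e) := by
  rw [setLIntegral_congr_fun (g := fun _ => G e) (measurableSet_initCylinder n e)
    fun ω hω => hG ω e hω]
  simp

lemma lintegral_eq_tsum_initCylinder (μ : Measure (ℕ → Bool)) (n : ℕ)
    (G : (ℕ → Bool) → ENNReal) :
    ∫⁻ ω, G ω ∂μ = ∑' v : Fin n → Bool,
      ∫⁻ ω in initCylinder n (fun k => if hk : k < n then v ⟨k, hk⟩ else true), G ω ∂μ := by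
  rw [← lintegral_iUnion (fun v => measurableSet_initCylinder n _)]
  · rw [show (⋃ v : Fin n → Bool,
      initCylinder n (fun k => if hk : k < n then v ⟨k, hk⟩ else true)) = Set.univ from ?_,
      Measure.restrict_univ]
    refine Set.eq_univ_of_forall fun ω => Set.mem_iUnion.2 ⟨fun i => ω i, fun k hk => ?_⟩
    simp [hk]
  · refine fun v v' hv => Set.disjoint_left.2 fun ω h1 h2 => hv ?_
    funext i
    have a := h1 i i.2
    have b := h2 i i.2
    simp only [i.2, dite_true, Fin.eta] at a b
    rw [← a, ← b]

/-- One-step comparison: if the conditional expectation of `G` given the first `n` coordinates is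
at most `K * F`, then the same holds for the integrals. -/
lemma lintegral_le_of_step {μ : Measure (ℕ → Bool)} {n : ℕ} {P : Bool → (ℕ → Bool) → ENNReal}
    (hP : ∀ b e, μ (initCylinder (n + 1) (Function.update e n b)) =
      P b e * μ (initCylinder n e))
    {F G : (ℕ → Bool) → ENNReal} {K : ENNReal} (hK : K ≠ ⊤)
    (hF : ∀ ω ω' : ℕ → Bool, (∀ k < n, ω k = ω' k) → F ω = F ω')
    (hG : ∀ ω ω' : ℕ → Bool, (∀ k < n + 1, ω k = ω' k) → G ω = G ω')
    (hGF : ∀ e, P true e * G (Function.update e n true) +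
      P false e * G (Function.update e n false) ≤ K * F e) :
    ∫⁻ ω, G ω ∂μ ≤ K * ∫⁻ ω, F ω ∂μ := by
  rw [← lintegral_const_mul' _ _ hK, lintegral_eq_tsum_initCylinder μ n G,
    lintegral_eq_tsum_initCylinder μ n fun ω => K * F ω]
  refine ENNReal.tsum_le_tsum fun v => ?_
  generalize (fun k => if hk : k < n then v ⟨k, hk⟩ else true) = e
  rw [setLIntegral_initCylinder μ (G := fun ω => K * F ω) (fun ω ω' h => by rw [hF ω ω' h]) e]
  conv_lhs => rw [initCylinder_eq_union]
  rw [lintegral_union (measurableSet_initCylinder _ _) (disjoint_initCylinder_update n e),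
    setLIntegral_initCylinder μ hG, setLIntegral_initCylinder μ hG, hP, hP]
  calc _ = (P true e * G (Function.update e n true) +
        P false e * G (Function.update e n false)) * μ (initCylinder n e) := by ring
    _ ≤ _ := by gcongr; exact hGF e

lemma exp_le_one_add_add_sq {x : ℝ} (hx : |x| ≤ 1) : Real.exp x ≤ 1 + x + x ^ 2 := by
  have := (abs_le.1 (Real.abs_exp_sub_one_sub_id_le hx)).2
  linarith

/-- A law of large numbers from exponential moment bounds (upper half). -/
lemma ae_eventually_lt_of_exp_moment {Ω : Type*} [MeasurableSpace Ω] {μ : Measure Ω}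
    {S : ℕ → Ω → ℝ} (hS : ∀ n, Measurable (S n)) {a ρ ε : ℝ} (hρ : 0 ≤ ρ)
    (hε : ρ * Real.exp (-(a * ε)) < 1) (ha : 0 < a)
    (hexp : ∀ n, ∫⁻ ω, ENNReal.ofReal (Real.exp (a * S n ω)) ∂μ ≤ ENNReal.ofReal ρ ^ n) :
    ∀ᵐ ω ∂μ, ∀ᶠ n in atTop, S n ω < ε * n := by
  have hb : ∀ n, μ {ω | ε * n ≤ S n ω} ≤ ENNReal.ofReal (ρ * Real.exp (-(a * ε))) ^ n := by
    intro n
    have hm : Measurable fun ω => ENNReal.ofReal (Real.exp (a * S n ω)) :=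
      (Real.measurable_exp.comp ((hS n).const_mul a)).ennreal_ofReal
    have h1 := (mul_meas_ge_le_lintegral (μ := μ) hm
      (ENNReal.ofReal (Real.exp (a * ε) ^ n))).trans (hexp n)
    have hset : {ω | ε * n ≤ S n ω} ⊆ {ω | ENNReal.ofReal (Real.exp (a * ε) ^ n) ≤
        ENNReal.ofReal (Real.exp (a * S n ω))} := by
      intro ω hω
      refine ENNReal.ofReal_le_ofReal ?_
      rw [← Real.exp_nat_mul]
      refine Real.exp_le_exp.2 ?_
      have : a * (ε * n) ≤ a * S n ω := mul_le_mul_of_nonneg_left hω ha.le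
      linarith
    have h2 : ENNReal.ofReal (Real.exp (-(a * ε)) ^ n) * ENNReal.ofReal (Real.exp (a * ε) ^ n)
        = 1 := by
      rw [← ENNReal.ofReal_mul (by positivity), ← mul_pow, ← Real.exp_add]
      simp
    calc μ {ω | ε * n ≤ S n ω} ≤ μ {ω | ENNReal.ofReal (Real.exp (a * ε) ^ n) ≤
          ENNReal.ofReal (Real.exp (a * S n ω))} := measure_mono hset
      _ = ENNReal.ofReal (Real.exp (-(a * ε)) ^ n) * (ENNReal.ofReal (Real.exp (a * ε) ^ n) *
          μ {ω | ENNReal.ofReal (Real.exp (a * ε) ^ n) ≤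
            ENNReal.ofReal (Real.exp (a * S n ω))}) := by rw [← mul_assoc, h2, one_mul]
      _ ≤ ENNReal.ofReal (Real.exp (-(a * ε)) ^ n) * ENNReal.ofReal ρ ^ n := by gcongr
      _ = _ := by
        rw [← ENNReal.ofReal_pow hρ, ← ENNReal.ofReal_mul (by positivity), ← mul_pow,
          ENNReal.ofReal_pow (by positivity), mul_comm]
  have hlt : ENNReal.ofReal (ρ * Real.exp (-(a * ε))) < 1 := by
    rw [← ENNReal.ofReal_one]
    exact (ENNReal.ofReal_lt_ofReal_iff one_pos).2 hε
  have hsum : ∑' n, μ {ω | ε * n ≤ S n ω} ≠ ⊤ := by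
    refine ne_top_of_le_ne_top ?_ (ENNReal.tsum_le_tsum hb)
    rw [ENNReal.tsum_geometric]
    exact ENNReal.inv_ne_top.2 (tsub_pos_of_lt hlt).ne'
  filter_upwards [ae_eventually_notMem hsum] with ω hω
  filter_upwards [hω] with n hn
  simpa using hn

/-- A strong law of large numbers from exponential moment bounds. -/
lemma ae_tendsto_div_of_exp_moment {Ω : Type*} [MeasurableSpace Ω] {μ : Measure Ω}
    {S : ℕ → Ω → ℝ} (hS : ∀ n, Measurable (S n)) {C : ℝ} (hC : 0 < C)
    (hexp : ∀ a : ℝ, |a| * C ≤ 1 → ∀ n,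
      ∫⁻ ω, ENNReal.ofReal (Real.exp (a * S n ω)) ∂μ ≤ ENNReal.ofReal (1 + (a * C) ^ 2) ^ n) :
    ∀ᵐ ω ∂μ, Tendsto (fun n : ℕ => S n ω / n) atTop (𝓝 0) := by
  have rate : ∀ ε : ℝ, 0 < ε → ∃ a : ℝ, 0 < a ∧ |a| * C ≤ 1 ∧
      (1 + (a * C) ^ 2) * Real.exp (-(a * ε)) < 1 := by
    intro ε hε
    set a := min (1 / C) (ε / (2 * C ^ 2)) with ha
    have ha0 : 0 < a := by positivity
    refine ⟨a, ha0, ?_, ?_⟩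
    · rw [abs_of_pos ha0]
      exact (le_div_iff₀ hC).1 (min_le_left _ _)
    · have h1 : a * (2 * C ^ 2) ≤ ε := (le_div_iff₀ (by positivity)).1 (min_le_right _ _)
      have h2 : 1 + (a * C) ^ 2 < Real.exp (a * ε) := by
        have h3 := Real.add_one_le_exp (a * ε)
        have h4 : a * (a * (2 * C ^ 2)) ≤ a * ε := mul_le_mul_of_nonneg_left h1 ha0.le
        have h5 : 0 < a ^ 2 * C ^ 2 := by positivity
        nlinarith
      rw [Real.exp_neg, ← div_eq_mul_inv, div_lt_one (Real.exp_pos _)]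
      exact h2
  have main : ∀ᵐ ω ∂μ, ∀ m : ℕ, ∀ᶠ n : ℕ in atTop, |S n ω| < 1 / ((m : ℝ) + 1) * n := by
    rw [ae_all_iff]
    intro m
    obtain ⟨a, ha0, ha1, ha2⟩ := rate (1 / ((m : ℝ) + 1)) (by positivity)
    have hup := ae_eventually_lt_of_exp_moment hS (by positivity) ha2 ha0 (hexp a ha1)
    have hdown := ae_eventually_lt_of_exp_moment (S := fun n ω => -S n ω) (μ := μ)
      (fun n => (hS n).neg) (by positivity) ha2 ha0 (fun n => by
        have := hexp (-a) (by rwa [abs_neg]) n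
        simpa using this)
    filter_upwards [hup, hdown] with ω h1 h2
    filter_upwards [h1, h2] with n h1 h2
    exact abs_lt.2 ⟨by linarith, h1⟩
  filter_upwards [main] with ω hω
  rw [Metric.tendsto_atTop']
  intro ε hε
  obtain ⟨m, hm⟩ := exists_nat_one_div_lt hε
  obtain ⟨n0, hn0⟩ := eventually_atTop.1 (hω m)
  refine ⟨n0, fun n hn => ?_⟩
  have hn' : (0 : ℝ) < n := by exact_mod_cast (Nat.zero_le n0).trans_lt hn
  rw [Real.dist_eq, sub_zero, abs_div, abs_of_pos hn', div_lt_iff₀ hn']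
  exact (hn0 n hn.le).trans (by gcongr)

/-- The jump probability as a function of the number of right jumps in the window. -/
noncomputable def jumpProb (M : ℕ) (p0 p1 : ℝ) (c : ℕ) : ℝ := if M ≤ c then p1 else p0

/-- An invariant weight of the window process, as a function of the number of right jumps. -/
noncomputable def windowWeight (M : ℕ) (p0 p1 : ℝ) (c : ℕ) : ℝ :=
  if c < M then 1 / (1 - p0) * (p0 / (1 - p0)) ^ c
  else 1 / (1 - p1) * (p0 / (1 - p0)) ^ M * (p1 / (1 - p1)) ^ (c - M)

lemma windowWeight_pos {M : ℕ} {p0 p1 : ℝ} (h0 : 0 < p0) (h01 : p0 < p1) (h1 : p1 < 1) (c : ℕ) :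
    0 < windowWeight M p0 p1 c := by
  have a : 0 < 1 - p0 := by linarith
  have b : 0 < 1 - p1 := by linarith
  have d : 0 < p1 := by linarith
  unfold windowWeight
  split_ifs <;> positivity

lemma windowWeight_balance {M : ℕ} {p0 p1 : ℝ} (h01 : p0 < p1) (h1 : p1 < 1) (c : ℕ) :
    windowWeight M p0 p1 c * jumpProb M p0 p1 c =
      windowWeight M p0 p1 (c + 1) * (1 - jumpProb M p0 p1 (c + 1)) := by
  have a : 1 - p0 ≠ 0 := by linarith
  have b : 1 - p1 ≠ 0 := by linarith
  unfold windowWeight jumpProb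
  rcases lt_trichotomy (c + 1) M with h | h | h
  · rw [if_pos (by omega), if_neg (by omega), if_pos h, if_neg (by omega), pow_succ]
    field_simp
  · rw [if_pos (by omega), if_neg (by omega), if_neg (by omega), if_pos (by omega), ← h]
    simp only [Nat.sub_self, pow_zero, pow_succ]
    field_simp
  · rw [if_neg (by omega), if_pos (by omega), if_neg (by omega), if_pos (by omega),
      Nat.sub_add_comm (by omega), pow_succ]
    field_simp

lemma sum_windowWeight {N M : ℕ} (hMN : M ≤ N) (p0 p1 : ℝ) (F : ℕ → ℝ) :
    ∑ w : Fin N → Bool, windowWeight M p0 p1 (ones w) * F (ones w) =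
      (1 / (1 - p0)) * ∑ j ∈ Finset.range M, F j * (N.choose j) * (p0 / (1 - p0)) ^ j
      + (1 / (1 - p1)) * (p0 / (1 - p0)) ^ M * ∑ j ∈ Finset.Icc M N,
        F j * (N.choose j) * (p1 / (1 - p1)) ^ (j - M) := by
  rw [sum_window_ones fun k => windowWeight M p0 p1 k * F k,
    ← Finset.sum_range_add_sum_Ico _ (show M ≤ N + 1 by omega), Finset.mul_sum, Finset.mul_sum]
  congr 1
  · refine Finset.sum_congr rfl fun j hj => ?_
    rw [windowWeight, if_pos (Finset.mem_range.1 hj)]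
    ring
  · refine Finset.sum_congr (by ext; simp) fun j hj => ?_
    rw [windowWeight, if_neg (by simp at hj; omega)]
    ring

lemma speed1_eq {N M : ℕ} (hMN : M ≤ N) (p0 p1 : ℝ) :
    speed1 N M p0 p1 =
      (∑ w : Fin N → Bool, windowWeight M p0 p1 (ones w) * (2 * (ones w : ℝ) / N - 1)) /
        ∑ w : Fin N → Bool, windowWeight M p0 p1 (ones w) := by
  have e1 := sum_windowWeight hMN p0 p1 fun j => 2 * (j : ℝ) / N - 1
  have e2 := sum_windowWeight hMN p0 p1 fun _ => 1
  simp only [mul_one, one_mul] at e2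
  rw [e1, e2, speed1]

lemma sum_windowWeight_sub_speed {N M : ℕ} (hMN : M ≤ N) {p0 p1 : ℝ} (h0 : 0 < p0)
    (h01 : p0 < p1) (h1 : p1 < 1) :
    ∑ w : Fin N → Bool, windowWeight M p0 p1 (ones w) *
      (2 * (ones w : ℝ) / N - 1 - speed1 N M p0 p1) = 0 := by
  have hpos : 0 < ∑ w : Fin N → Bool, windowWeight M p0 p1 (ones w) :=
    Finset.sum_pos (fun w _ => windowWeight_pos h0 h01 h1 _) Finset.univ_nonempty
  simp only [mul_sub _ _ (speed1 N M p0 p1), Finset.sum_sub_distrib, ← Finset.sum_mul]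
  rw [speed1_eq hMN, mul_div_cancel₀ _ hpos.ne', sub_self]

lemma card_filter_Ico_eq_ones (N k : ℕ) (e : ℕ → Bool) :
    ((Finset.Ico k (k + N)).filter (fun j => e j = true)).card = ones (window N e k) := by
  rw [Finset.card_filter, Finset.sum_Ico_eq_sum_range, Nat.add_sub_cancel_left,
    Finset.sum_range]
  refine Finset.sum_congr rfl fun i _ => ?_
  simp only [window]
  cases e (k + i) <;> rfl

lemma stepProb1_window (N M : ℕ) (p0 p1 : ℝ) (e : ℕ → Bool) (k : ℕ) :
    stepProb1 N M p0 p1 e (k + N) =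
      if e (k + N) then jumpProb M p0 p1 (ones (window N e k))
      else 1 - jumpProb M p0 p1 (ones (window N e k)) := by
  simp only [stepProb1, jumpProb]
  rw [if_neg (show ¬k + N < N by omega), Nat.add_sub_cancel, card_filter_Ico_eq_ones]

lemma stepProb1_congr (N M : ℕ) (p0 p1 : ℝ) {e e' : ℕ → Bool} {n : ℕ}
    (h : ∀ k ≤ n, e k = e' k) : stepProb1 N M p0 p1 e n = stepProb1 N M p0 p1 e' n := by
  have hf : (Finset.Ico (n - N) n).filter (fun k => e k = true) =
      (Finset.Ico (n - N) n).filter (fun k => e' k = true) := by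
    refine Finset.filter_congr fun k hk => ?_
    rw [h k (Finset.mem_Ico.1 hk).2.le]
  simp only [stepProb1, hf, h n le_rfl]

lemma stepProb1_nonneg {N M : ℕ} {p0 p1 : ℝ} (h0 : 0 < p0) (h01 : p0 < p1) (h1 : p1 < 1)
    (e : ℕ → Bool) (n : ℕ) : 0 ≤ stepProb1 N M p0 p1 e n := by
  simp only [stepProb1]
  split_ifs <;> linarith

lemma measure_initCylinder_update {N M : ℕ} {p0 p1 : ℝ} (h0 : 0 < p0) (h01 : p0 < p1)
    (h1 : p1 < 1) {μ : Measure (ℕ → Bool)}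
    (hμ : ∀ (n : ℕ) (e : ℕ → Bool), μ (initCylinder n e) =
      ENNReal.ofReal (∏ k ∈ Finset.range n, stepProb1 N M p0 p1 e k))
    (n : ℕ) (b : Bool) (e : ℕ → Bool) :
    μ (initCylinder (n + 1) (Function.update e n b)) =
      ENNReal.ofReal (stepProb1 N M p0 p1 (Function.update e n b) n) * μ (initCylinder n e) := by
  rw [hμ, hμ, Finset.prod_range_succ, mul_comm,
    ENNReal.ofReal_mul (stepProb1_nonneg h0 h01 h1 _ _)]
  congr 2
  refine Finset.prod_congr rfl fun k hk => stepProb1_congr _ _ _ _ fun j hj => ?_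
  have := Finset.mem_range.1 hk
  rw [Function.update_of_ne (by omega)]

/-- The martingale part of `h` evaluated along the window process. -/
noncomputable def martPart {n : ℕ} (q : ℕ → ℝ) (h : (Fin (n + 1) → Bool) → ℝ) (L : ℕ)
    (ω : ℕ → Bool) : ℝ :=
  ∑ k ∈ Finset.range L, (h (window (n + 1) ω (k + 1)) - transOp n q h (window (n + 1) ω k))

lemma window_congr {n k m : ℕ} {ω ω' : ℕ → Bool} (h : ∀ j < m, ω j = ω' j) (hk : k + n ≤ m) :
    window n ω k = window n ω' k := by
  funext i
  exact h _ (by omega)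

lemma martPart_congr {n : ℕ} (q : ℕ → ℝ) (h : (Fin (n + 1) → Bool) → ℝ) {L : ℕ}
    {ω ω' : ℕ → Bool} (hω : ∀ j < L + (n + 1), ω j = ω' j) :
    martPart q h L ω = martPart q h L ω' := by
  refine Finset.sum_congr rfl fun k hk => ?_
  have := Finset.mem_range.1 hk
  rw [window_congr hω (k := k) (by omega), window_congr hω (k := k + 1) (by omega)]

lemma measurable_window (n k : ℕ) : Measurable fun ω => window n ω k :=
  measurable_pi_iff.2 fun _ => measurable_pi_apply _

lemma measurable_martPart {n : ℕ} (q : ℕ → ℝ) (h : (Fin (n + 1) → Bool) → ℝ) (L : ℕ) :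
    Measurable (martPart q h L) :=
  Finset.measurable_sum _ fun _ _ =>
    ((measurable_of_finite h).comp (measurable_window _ _)).sub
      ((measurable_of_finite (transOp n q h)).comp (measurable_window _ _))

lemma two_point_exp_le {q x y c : ℝ} (hq0 : 0 ≤ q) (hq1 : q ≤ 1) (hx : |x| ≤ c) (hy : |y| ≤ c)
    (hc : c ≤ 1) (hxy : q * x + (1 - q) * y = 0) :
    q * Real.exp x + (1 - q) * Real.exp y ≤ 1 + c ^ 2 := by
  have e1 := exp_le_one_add_add_sq (hx.trans hc)
  have e2 := exp_le_one_add_add_sq (hy.trans hc)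
  have e3 := sq_le_sq' (abs_le.1 hx).1 (abs_le.1 hx).2
  have e4 := sq_le_sq' (abs_le.1 hy).1 (abs_le.1 hy).2
  have hq1' : 0 ≤ 1 - q := by linarith
  have e5 := mul_le_mul_of_nonneg_left (show Real.exp x ≤ 1 + x + c ^ 2 by linarith) hq0
  have e6 := mul_le_mul_of_nonneg_left (show Real.exp y ≤ 1 + y + c ^ 2 by linarith) hq1'
  linarith

lemma abs_transOp_le {n : ℕ} {q : ℕ → ℝ} (hq0 : ∀ c, 0 < q c) (hq1 : ∀ c, q c < 1)
    {h : (Fin (n + 1) → Bool) → ℝ} {B : ℝ} (hB : ∀ w, |h w| ≤ B) (w : Fin (n + 1) → Bool) :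
    |transOp n q h w| ≤ B := by
  rw [transOp_apply]
  have a := hq0 (ones w)
  have b : 0 < 1 - q (ones w) := by linarith [hq1 (ones w)]
  have c := abs_le.1 (hB (shiftWindow w true))
  have d := abs_le.1 (hB (shiftWindow w false))
  exact abs_le.2 ⟨by nlinarith, by nlinarith⟩

lemma lintegral_exp_martPart_le {n M : ℕ} {p0 p1 : ℝ} (h0 : 0 < p0) (h01 : p0 < p1) (h1 : p1 < 1)
    {μ : Measure (ℕ → Bool)} [IsProbabilityMeasure μ]
    (hμ : ∀ (m : ℕ) (e : ℕ → Bool), μ (initCylinder m e) =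
      ENNReal.ofReal (∏ k ∈ Finset.range m, stepProb1 (n + 1) M p0 p1 e k))
    {h : (Fin (n + 1) → Bool) → ℝ} {B : ℝ} (hB : ∀ w, |h w| ≤ B)
    {a : ℝ} (ha : |a| * (2 * B) ≤ 1) (L : ℕ) :
    ∫⁻ ω, ENNReal.ofReal (Real.exp (a * martPart (jumpProb M p0 p1) h L ω)) ∂μ ≤
      ENNReal.ofReal (1 + (a * (2 * B)) ^ 2) ^ L := by
  have hq0 : ∀ c, 0 < jumpProb M p0 p1 c := fun c => by unfold jumpProb; split_ifs <;> linarith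
  have hq1 : ∀ c, jumpProb M p0 p1 c < 1 := fun c => by unfold jumpProb; split_ifs <;> linarith
  induction L with
  | zero => simp [martPart]
  | succ L ih =>
    rw [pow_succ']
    refine le_trans ?_ (mul_le_mul_right ih _)
    refine lintegral_le_of_step (n := L + (n + 1))
      (fun b e => measure_initCylinder_update h0 h01 h1 hμ _ b e) ENNReal.ofReal_ne_top
      (fun ω ω' hω => by rw [martPart_congr _ _ hω])
      (fun ω ω' hω => by rw [martPart_congr _ _ fun j hj => hω j (by omega)]) fun e => ?_
    set w := window (n + 1) e L with hw
    have hup : ∀ b, ∀ j < L + (n + 1), Function.update e (L + (n + 1)) b j = e j :=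
      fun b j hj => Function.update_of_ne hj.ne _ _
    have hwin : ∀ b, window (n + 1) (Function.update e (L + (n + 1)) b) L = w :=
      fun b => window_congr (hup b) le_rfl
    have hmart : ∀ b, martPart (jumpProb M p0 p1) h (L + 1) (Function.update e (L + (n + 1)) b) =
        martPart (jumpProb M p0 p1) h L e +
          (h (shiftWindow w b) - transOp n (jumpProb M p0 p1) h w) := by
      intro b
      have hprev := martPart_congr (jumpProb M p0 p1) h (L := L) (hup b)
      have hsucc : martPart (jumpProb M p0 p1) h (L + 1) (Function.update e (L + (n + 1)) b) =
          martPart (jumpProb M p0 p1) h L (Function.update e (L + (n + 1)) b) + _ :=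
        Finset.sum_range_succ _ _
      rw [hsucc, hprev, window_succ, hwin, Function.update_self]
    have hd : ∀ b, |a * (h (shiftWindow w b) - transOp n (jumpProb M p0 p1) h w)| ≤
        |a| * (2 * B) := by
      intro b
      rw [abs_mul]
      refine mul_le_mul_of_nonneg_left ?_ (abs_nonneg a)
      have := abs_sub (h (shiftWindow w b)) (transOp n (jumpProb M p0 p1) h w)
      linarith [hB (shiftWindow w b), abs_transOp_le hq0 hq1 hB w]
    have key := two_point_exp_le (hq0 (ones w)).le (hq1 (ones w)).le (hd true) (hd false) ha
      (by rw [transOp_apply]; ring)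
    rw [stepProb1_window, stepProb1_window, hwin, hwin, hmart, hmart, Function.update_self,
      Function.update_self, ← ENNReal.ofReal_mul (by simpa using (hq0 _).le),
      ← ENNReal.ofReal_mul (by simpa using (hq1 _).le), ← ENNReal.ofReal_mul (by positivity),
      ← ENNReal.ofReal_add
        (mul_nonneg (by simpa using (hq0 _).le) (Real.exp_pos _).le)
        (mul_nonneg (by simpa using (hq1 _).le) (Real.exp_pos _).le)]
    refine ENNReal.ofReal_le_ofReal ?_
    have hsq : (a * (2 * B)) ^ 2 = (|a| * (2 * B)) ^ 2 := by rw [mul_pow, mul_pow |a|, sq_abs]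
    rw [hsq]
    simp only [mul_add, Real.exp_add, if_true, Bool.false_eq_true, if_false]
    have := mul_le_mul_of_nonneg_right key
      (Real.exp_pos (a * martPart (jumpProb M p0 p1) h L e)).le
    linarith

lemma abs_sum_range_shift_sub_le {ξ : ℕ → ℝ} (hξ : ∀ k, |ξ k| ≤ 1) (L i : ℕ) :
    |∑ k ∈ Finset.range L, ξ (k + i) - ∑ k ∈ Finset.range L, ξ k| ≤ 2 * i := by
  induction i with
  | zero => simp
  | succ i ih =>
    have tel := Finset.sum_range_sub (fun k => ξ (k + i)) L
    rw [Finset.sum_sub_distrib] at tel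
    simp only [zero_add, add_right_comm _ 1 i] at tel
    simp only [← add_assoc]
    have a := abs_le.1 (hξ (L + i))
    have b := abs_le.1 (hξ i)
    have c := abs_le.1 ih
    push_cast
    exact abs_le.2 ⟨by linarith, by linarith⟩

lemma abs_walkPos_sub_sum_window_le {N : ℕ} (hN : 0 < N) (ω : ℕ → Bool) (L : ℕ) :
    |(walkPos ω L : ℝ) - ∑ k ∈ Finset.range L, (2 * (ones (window N ω k) : ℝ) / N - 1)| ≤
      2 * N := by
  set ξ : ℕ → ℝ := fun k => if ω k then 1 else -1 with hξ
  have hN' : (0 : ℝ) < N := by exact_mod_cast hN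
  have hb : ∀ k, |ξ k| ≤ 1 := fun k => by simp only [hξ]; split_ifs <;> simp
  have hw : (walkPos ω L : ℝ) = ∑ k ∈ Finset.range L, ξ k := by
    simp [walkPos, hξ]
  have hones : ∀ k, 2 * (ones (window N ω k) : ℝ) / N - 1 =
      (∑ i ∈ Finset.range N, ξ (k + i)) / N := by
    intro k
    have : ∑ i ∈ Finset.range N, ξ (k + i) = 2 * (ones (window N ω k) : ℝ) - N := by
      have hx : ∀ j, ξ j = 2 * ((ω j).toNat : ℝ) - 1 := fun j => by
        simp only [hξ]
        cases ω j <;> norm_num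
      simp only [hx, Finset.sum_sub_distrib, ← Finset.mul_sum, ones, window]
      push_cast
      rw [Finset.sum_range]
      simp
    rw [this, sub_div, div_self hN'.ne']
  have hsum : (walkPos ω L : ℝ) - ∑ k ∈ Finset.range L, (2 * (ones (window N ω k) : ℝ) / N - 1) =
      -(∑ i ∈ Finset.range N,
        (∑ k ∈ Finset.range L, ξ (k + i) - ∑ k ∈ Finset.range L, ξ k)) / N := by
    rw [hw, Finset.sum_congr rfl fun k _ => hones k, ← Finset.sum_div, Finset.sum_comm,
      Finset.sum_sub_distrib, Finset.sum_const, Finset.card_range, nsmul_eq_mul]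
    field_simp
    ring
  rw [hsum, abs_div, abs_neg, abs_of_pos hN', div_le_iff₀ hN']
  refine (Finset.abs_sum_le_sum_abs _ _).trans ?_
  calc _ ≤ ∑ i ∈ Finset.range N, (2 * N : ℝ) := Finset.sum_le_sum fun i hi =>
        (abs_sum_range_shift_sub_le hb L i).trans (by
          have : (i : ℝ) ≤ N := by exact_mod_cast (Finset.mem_range.1 hi).le
          linarith)
    _ = 2 * N * N := by simp; ring

/-- Theorem 1.1: for the random walk excited by its recent history, with history
window `N`, threshold `1 ≤ M ≤ N` and `0 < p0 < p1 < 1`, almost surely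
`X_n / n` converges, and its limit is the explicit expression `speed1 N M p0 p1`. -/
theorem speed_of_excited_rw (N M : ℕ) (hM1 : 1 ≤ M) (hMN : M ≤ N)
    (p0 p1 : ℝ) (h0 : 0 < p0) (h01 : p0 < p1) (h1 : p1 < 1)
    (μ : Measure (ℕ → Bool)) [IsProbabilityMeasure μ]
    (hμ : ∀ (n : ℕ) (e : ℕ → Bool),
      μ {ω | ∀ k < n, ω k = e k} =
        ENNReal.ofReal (∏ k ∈ Finset.range n, stepProb1 N M p0 p1 e k)) :
    ∀ᵐ ω ∂μ, Tendsto (fun n => (walkPos ω n : ℝ) / n) atTop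
      (𝓝 (speed1 N M p0 p1)) := by
  obtain ⟨n, rfl⟩ : ∃ n, N = n + 1 := ⟨N - 1, by omega⟩
  have hq0 : ∀ c, 0 < jumpProb M p0 p1 c := fun c => by unfold jumpProb; split_ifs <;> linarith
  have hq1 : ∀ c, jumpProb M p0 p1 c < 1 := fun c => by unfold jumpProb; split_ifs <;> linarith
  obtain ⟨h, hh⟩ := exists_poisson hq0 hq1 (windowWeight_pos h0 h01 h1)
    (windowWeight_balance h01 h1) (sum_windowWeight_sub_speed hMN h0 h01 h1)
  set s := speed1 (n + 1) M p0 p1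
  set S := martPart (jumpProb M p0 p1) h with hS
  obtain ⟨B, hB0, hB⟩ : ∃ B : ℝ, 0 < B ∧ ∀ w, |h w| ≤ B := by
    obtain ⟨w, hw⟩ := Finite.exists_max fun w => |h w|
    exact ⟨|h w| + 1, by positivity, fun v => (hw v).trans (by linarith)⟩
  have hlln : ∀ᵐ ω ∂μ, Tendsto (fun L : ℕ => S L ω / L) atTop (𝓝 0) :=
    ae_tendsto_div_of_exp_moment (measurable_martPart _ h) (by positivity : 0 < 2 * B)
      fun a ha L => lintegral_exp_martPart_le h0 h01 h1 hμ hB ha L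
  filter_upwards [hlln] with ω hω
  have hdecomp : ∀ L : ℕ, ∑ k ∈ Finset.range L,
      (2 * (ones (window (n + 1) ω k) : ℝ) / (n + 1 : ℕ) - 1) =
      s * L + S L ω + (h (window (n + 1) ω 0) - h (window (n + 1) ω L)) := by
    intro L
    have tel := Finset.sum_range_sub (fun k => h (window (n + 1) ω k)) L
    have hp : ∀ k, 2 * (ones (window (n + 1) ω k) : ℝ) / (n + 1 : ℕ) - 1 =
        s + (h (window (n + 1) ω (k + 1)) -
          transOp n (jumpProb M p0 p1) h (window (n + 1) ω k)) -
          (h (window (n + 1) ω (k + 1)) - h (window (n + 1) ω k)) := by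
      intro k
      have := congrFun hh (window (n + 1) ω k)
      simp only [Pi.sub_apply] at this
      linarith
    rw [Finset.sum_congr rfl fun k _ => hp k, Finset.sum_sub_distrib, Finset.sum_add_distrib, tel]
    simp only [hS, martPart, Finset.sum_const, Finset.card_range, nsmul_eq_mul]
    ring
  have hrest : ∀ L : ℕ, |(walkPos ω L : ℝ) - s * L - S L ω| ≤ 2 * (n + 1 : ℕ) + 2 * B := by
    intro L
    have a := abs_le.1 (abs_walkPos_sub_sum_window_le (Nat.succ_pos n) ω L)
    rw [hdecomp L] at a
    have b := abs_le.1 (hB (window (n + 1) ω 0))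
    have c := abs_le.1 (hB (window (n + 1) ω L))
    exact abs_le.2 ⟨by linarith [a.1], by linarith [a.2]⟩
  have hzero : Tendsto (fun L : ℕ => ((walkPos ω L : ℝ) - s * L - S L ω) / L) atTop (𝓝 0) := by
    refine squeeze_zero_norm (fun L => ?_)
      (tendsto_const_div_atTop_nhds_zero_nat (2 * ((n + 1 : ℕ) : ℝ) + 2 * B))
    rw [Real.norm_eq_abs, abs_div, Nat.abs_cast]
    exact div_le_div_of_nonneg_right (hrest L) (Nat.cast_nonneg L)
  have hlim := (hzero.add hω).const_add s
  rw [add_zero, add_zero] at hlim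
  refine hlim.congr' ?_
  filter_upwards [eventually_gt_atTop 0] with L hL
  have hL' : (L : ℝ) ≠ 0 := by exact_mod_cast hL.ne'
  field_simp
  ring
end

section
/- For integers N ≥ 1 and reals 0 < p0 < p1 < 1, the explicit speed expression s(N,M;p0,p1) evaluated at M = N simplifies to s(N,N;p0,p1) = [ p0^N (p1 − p0) + (1 − p1)(2 p0 − 1) ] / [ p0^N (p1 − p0) + 1 − p1 ]. -/
open Filter Finset Topology

/-- The derivative form of the binomial theorem. -/
lemma sum_range_mul_choose_mul_pow (n : ℕ) (r : ℝ) :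
    ∑ j ∈ Finset.range (n + 2), (j : ℝ) * ((n + 1).choose j) * r ^ j =
      (n + 1) * r * (1 + r) ^ n := by
  rw [Finset.sum_range_succ', add_comm 1 r, add_pow, Finset.mul_sum]
  simp only [Nat.cast_zero, zero_mul, add_zero]
  refine Finset.sum_congr rfl fun k _ => ?_
  have h : ((n : ℝ) + 1) * n.choose k = (n + 1).choose (k + 1) * (k + 1) := by
    exact_mod_cast Nat.add_one_mul_choose_eq n k
  rw [one_pow]
  push_cast
  linear_combination (-(r ^ (k + 1))) * h

/-- At `M = N`, the speed simplifies:
`s(N,N;p₀,p₁) = (p₀^N (p₁-p₀) + (1-p₁)(2p₀-1)) / (p₀^N (p₁-p₀) + 1 - p₁)`. -/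
theorem speed1_at_M_eq_N (N : ℕ) (hN : 1 ≤ N) (p0 p1 : ℝ)
    (h0 : 0 < p0) (h01 : p0 < p1) (h1 : p1 < 1) :
    speed1 N N p0 p1 =
      (p0 ^ N * (p1 - p0) + (1 - p1) * (2 * p0 - 1)) /
        (p0 ^ N * (p1 - p0) + 1 - p1) := by
  obtain ⟨n, rfl⟩ : ∃ n, N = n + 1 := ⟨N - 1, by omega⟩
  have hq0 : 1 - p0 ≠ 0 := by linarith
  have hq1 : 1 - p1 ≠ 0 := by linarith
  have hn : (n : ℝ) + 1 ≠ 0 := by positivity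
  have hr : 1 + p0 / (1 - p0) = 1 / (1 - p0) := by field_simp; ring
  have hsum : ∑ j ∈ Finset.range (n + 1), ((n + 1).choose j : ℝ) * (p0 / (1 - p0)) ^ j =
      (1 - p0 ^ (n + 1)) / (1 - p0) ^ (n + 1) := by
    have h := add_pow (p0 / (1 - p0)) 1 (n + 1)
    rw [add_comm, hr, Finset.sum_range_succ] at h
    simp only [one_pow, mul_one, Nat.choose_self, Nat.cast_one, mul_comm _ (Nat.cast _),
      div_pow] at h
    simp only [div_pow]
    rw [sub_div]
    linarith
  have hmean : ∑ j ∈ Finset.range (n + 1),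
      (2 * (j : ℝ) / (n + 1 : ℕ) - 1) * ((n + 1).choose j) * (p0 / (1 - p0)) ^ j =
      (2 * p0 - 1 - p0 ^ (n + 1)) / (1 - p0) ^ (n + 1) := by
    have h := sum_range_mul_choose_mul_pow n (p0 / (1 - p0))
    rw [hr, Finset.sum_range_succ] at h
    have h' : ∀ j ∈ Finset.range (n + 1),
        (2 * (j : ℝ) / (n + 1 : ℕ) - 1) * ((n + 1).choose j) * (p0 / (1 - p0)) ^ j =
        2 / (n + 1) * ((j : ℝ) * ((n + 1).choose j) * (p0 / (1 - p0)) ^ j) -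
          ((n + 1).choose j) * (p0 / (1 - p0)) ^ j := fun j _ => by
      push_cast
      ring
    rw [Finset.sum_congr rfl h', Finset.sum_sub_distrib, ← Finset.mul_sum, hsum,
      eq_sub_of_add_eq h]
    simp only [Nat.choose_self, div_pow]
    push_cast
    field_simp
    ring
  have hN' : ((n + 1 : ℕ) : ℝ) ≠ 0 := by positivity
  have hone : 2 * ((n + 1 : ℕ) : ℝ) / (n + 1 : ℕ) - 1 = 1 := by field_simp; norm_num
  have hscale : (1 - p0) ^ (n + 2) * (1 - p1) ≠ 0 := mul_ne_zero (pow_ne_zero _ hq0) hq1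
  unfold speed1
  rw [hsum, hmean, Finset.Icc_self, Finset.sum_singleton, Finset.sum_singleton, hone,
    ← mul_div_mul_left _ _ hscale]
  simp only [Nat.choose_self, Nat.sub_self, pow_zero, Nat.cast_one, mul_one, div_pow]
  congr 1
  · field_simp
    ring
  · field_simp
    ring
end

section
/- Let 0 < p0 < p1 < 1 and let r*(p0,p1) = log((1−p0)/(1−p1)) / log( (p1/p0)·((1−p0)/(1−p1)) ). Suppose M_N is a sequence of integers with 1 ≤ M_N ≤ N and M_N/N → r as N → ∞. If 0 ≤ r < r*(p0,p1), then lim_{N→∞} s(N,M_N;p0,p1) = 2p1 − 1; if r*(p0,p1) < r ≤ 1, then lim_{N→∞} s(N,M_N;p0,p1) = 2p0 − 1. -/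
open Filter Finset Topology

/-- The critical threshold fraction `r*(p₀,p₁)`. -/
noncomputable def rstar (p0 p1 : ℝ) : ℝ :=
  Real.log ((1 - p0) / (1 - p1)) / Real.log ((p1 / p0) * ((1 - p0) / (1 - p1)))

/-- The probability that a binomial variable with parameters `N` and `p` equals `j`. -/
noncomputable def binomialWeight (N : ℕ) (p : ℝ) (j : ℕ) : ℝ :=
  N.choose j * p ^ j * (1 - p) ^ (N - j)

lemma binomialWeight_nonneg {p : ℝ} (hp0 : 0 ≤ p) (hp1 : p ≤ 1) (N j : ℕ) :
    0 ≤ binomialWeight N p j := by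
  have := sub_nonneg.2 hp1
  unfold binomialWeight
  positivity

lemma eval_bernsteinPolynomial_eq_binomialWeight (N : ℕ) (p : ℝ) (j : ℕ) :
    (bernsteinPolynomial ℝ N j).eval p = binomialWeight N p j := by
  simp [bernsteinPolynomial, binomialWeight]

lemma sum_binomialWeight (N : ℕ) (p : ℝ) :
    ∑ j ∈ range (N + 1), binomialWeight N p j = 1 := by
  simpa [Polynomial.eval_finsetSum, eval_bernsteinPolynomial_eq_binomialWeight] using
    congrArg (Polynomial.eval p) (bernsteinPolynomial.sum ℝ N)

lemma sum_mul_binomialWeight (N : ℕ) (p : ℝ) :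
    ∑ j ∈ range (N + 1), (j : ℝ) * binomialWeight N p j = N * p := by
  simpa [Polynomial.eval_finsetSum, eval_bernsteinPolynomial_eq_binomialWeight] using
    congrArg (Polynomial.eval p) (bernsteinPolynomial.sum_smul ℝ N)

lemma variance_binomialWeight (N : ℕ) (p : ℝ) :
    ∑ j ∈ range (N + 1), (N * p - j) ^ 2 * binomialWeight N p j = N * p * (1 - p) := by
  simpa [Polynomial.eval_finsetSum, eval_bernsteinPolynomial_eq_binomialWeight] using
    congrArg (Polynomial.eval p) (bernsteinPolynomial.variance ℝ N)

lemma sum_displacement_mul_binomialWeight {N : ℕ} (hN : N ≠ 0) (p : ℝ) :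
    ∑ j ∈ range (N + 1), (2 * (j : ℝ) / N - 1) * binomialWeight N p j = 2 * p - 1 := by
  have hN' : (N : ℝ) ≠ 0 := Nat.cast_ne_zero.2 hN
  calc
    _ = 2 / N * ∑ j ∈ range (N + 1), (j : ℝ) * binomialWeight N p j
        - ∑ j ∈ range (N + 1), binomialWeight N p j := by
      rw [mul_sum, ← sum_sub_distrib]
      exact sum_congr rfl fun j _ => by ring
    _ = 2 * p - 1 := by
      rw [sum_mul_binomialWeight, sum_binomialWeight]
      field_simp

lemma abs_displacement_le_one {N j : ℕ} (hj : j ≤ N) : |2 * (j : ℝ) / N - 1| ≤ 1 := by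
  have h1 : (j : ℝ) / N ≤ 1 := div_le_one_of_le₀ (by exact_mod_cast hj) (by positivity)
  have h0 : 0 ≤ (j : ℝ) / N := by positivity
  rw [abs_le, mul_div_assoc]
  constructor <;> linarith

lemma abs_sum_mul_binomialWeight_le {p : ℝ} (hp0 : 0 ≤ p) (hp1 : p ≤ 1) {N : ℕ}
    {s : Finset ℕ} {g : ℕ → ℝ} (hg : ∀ j ∈ s, |g j| ≤ 1) :
    |∑ j ∈ s, g j * binomialWeight N p j| ≤ ∑ j ∈ s, binomialWeight N p j := by
  refine (abs_sum_le_sum_abs _ _).trans (sum_le_sum fun j hj => ?_)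
  have hw := binomialWeight_nonneg hp0 hp1 N j
  rw [abs_mul, abs_of_nonneg hw]
  exact mul_le_of_le_one_left hw (hg j hj)

lemma sum_binomialWeight_le_one {p : ℝ} (hp0 : 0 ≤ p) (hp1 : p ≤ 1) {N : ℕ}
    {s : Finset ℕ} (hs : s ⊆ range (N + 1)) :
    ∑ j ∈ s, binomialWeight N p j ≤ 1 :=
  (sum_le_sum_of_subset_of_nonneg hs fun j _ _ => binomialWeight_nonneg hp0 hp1 N j).trans_eq
    (sum_binomialWeight N p)

/-- Chebyshev's inequality for the binomial distribution. -/
lemma sum_binomialWeight_le_of_far {p δ : ℝ} (hp0 : 0 ≤ p) (hp1 : p ≤ 1) (hδ : 0 < δ) {N : ℕ}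
    (hN : N ≠ 0) {s : Finset ℕ} (hs : s ⊆ range (N + 1))
    (hfar : ∀ j ∈ s, δ * N ≤ |N * p - j|) :
    ∑ j ∈ s, binomialWeight N p j ≤ p * (1 - p) / δ ^ 2 / N := by
  have hN' : (0 : ℝ) < N := Nat.cast_pos.2 (Nat.pos_of_ne_zero hN)
  have key : (δ * N) ^ 2 * ∑ j ∈ s, binomialWeight N p j ≤ N * p * (1 - p) := by
    rw [← variance_binomialWeight, mul_sum]
    calc
      _ ≤ ∑ j ∈ s, (N * p - j) ^ 2 * binomialWeight N p j := by
        refine sum_le_sum fun j hj => mul_le_mul_of_nonneg_right ?_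
          (binomialWeight_nonneg hp0 hp1 N j)
        rw [← sq_abs (N * p - j)]
        exact pow_le_pow_left₀ (by positivity) (hfar j hj) 2
      _ ≤ _ := sum_le_sum_of_subset_of_nonneg hs fun j _ _ =>
        mul_nonneg (sq_nonneg _) (binomialWeight_nonneg hp0 hp1 N j)
  rw [div_div, le_div_iff₀ (by positivity)]
  nlinarith

lemma tendsto_sum_binomialWeight_of_far {p δ : ℝ} (hp0 : 0 ≤ p) (hp1 : p ≤ 1) (hδ : 0 < δ)
    {s : ℕ → Finset ℕ} (hs : ∀ᶠ N in atTop, s N ⊆ range (N + 1))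
    (hfar : ∀ᶠ N : ℕ in atTop, ∀ j ∈ s N, δ * N ≤ |N * p - j|) :
    Tendsto (fun N => ∑ j ∈ s N, binomialWeight N p j) atTop (𝓝 0) := by
  refine squeeze_zero' (.of_forall fun N => sum_nonneg fun j _ =>
    binomialWeight_nonneg hp0 hp1 N j) ?_ (tendsto_const_div_atTop_nhds_zero_nat
      (p * (1 - p) / δ ^ 2))
  filter_upwards [hs, hfar, eventually_ne_atTop 0] with N h₁ h₂ h₃
  exact sum_binomialWeight_le_of_far hp0 hp1 hδ h₃ h₁ h₂

lemma tendsto_sum_displacement_of_far {p δ : ℝ} (hp0 : 0 ≤ p) (hp1 : p ≤ 1) (hδ : 0 < δ)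
    {s : ℕ → Finset ℕ} (hs : ∀ᶠ N in atTop, s N ⊆ range (N + 1))
    (hfar : ∀ᶠ N : ℕ in atTop, ∀ j ∈ s N, δ * N ≤ |N * p - j|) :
    Tendsto (fun N : ℕ => ∑ j ∈ s N, (2 * (j : ℝ) / N - 1) * binomialWeight N p j)
      atTop (𝓝 0) := by
  refine squeeze_zero_norm' ?_ (tendsto_sum_binomialWeight_of_far hp0 hp1 hδ hs hfar)
  filter_upwards [hs] with N hN
  exact abs_sum_mul_binomialWeight_le hp0 hp1 fun j hj =>
    abs_displacement_le_one (mem_range_succ_iff.1 (hN hj))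

lemma sum_range_add_sum_Icc {M N : ℕ} (h : M ≤ N) (f : ℕ → ℝ) :
    ∑ j ∈ range M, f j + ∑ j ∈ Icc M N, f j = ∑ j ∈ range (N + 1), f j := by
  rw [← Ico_add_one_right_eq_Icc]
  exact sum_range_add_sum_Ico f (by omega)

section Concentration

variable {p r : ℝ} {M : ℕ → ℕ}

lemma tendsto_sum_Icc_of_lt (hp0 : 0 ≤ p) (hp1 : p ≤ 1) (hM : ∀ᶠ N in atTop, M N ≤ N)
    (hr : Tendsto (fun N => (M N : ℝ) / N) atTop (𝓝 r)) (hrp : r < p) :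
    Tendsto (fun N => ∑ j ∈ Icc (M N) N, binomialWeight N p j) atTop (𝓝 1) ∧
    Tendsto (fun N : ℕ => ∑ j ∈ Icc (M N) N, (2 * (j : ℝ) / N - 1) * binomialWeight N p j)
      atTop (𝓝 (2 * p - 1)) := by
  have hδ : 0 < (p - r) / 2 := by linarith
  have hs : ∀ᶠ N in atTop, range (M N) ⊆ range (N + 1) := by
    filter_upwards [hM] with N hN
    exact range_subset_range.2 (by omega)
  have hfar : ∀ᶠ N : ℕ in atTop, ∀ j ∈ range (M N), (p - r) / 2 * N ≤ |N * p - j| := by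
    filter_upwards [hr.eventually_lt_const (show r < (p + r) / 2 by linarith),
      eventually_gt_atTop 0] with N h₁ h₂ j hj
    have hj' : (j : ℝ) ≤ M N := by exact_mod_cast (mem_range.1 hj).le
    rw [div_lt_iff₀ (by exact_mod_cast h₂)] at h₁
    exact le_trans (by linarith) (le_abs_self _)
  constructor
  · refine ((tendsto_sum_binomialWeight_of_far hp0 hp1 hδ hs hfar).const_sub 1).congr' ?_
      |>.trans_eq (by simp)
    filter_upwards [hM] with N hN
    rw [← sum_binomialWeight N p, ← sum_range_add_sum_Icc hN]
    ring
  · refine ((tendsto_sum_displacement_of_far hp0 hp1 hδ hs hfar).const_sub (2 * p - 1)).congr' ?_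
      |>.trans_eq (by simp)
    filter_upwards [hM, eventually_ne_atTop 0] with N hN hN0
    rw [← sum_displacement_mul_binomialWeight hN0 p, ← sum_range_add_sum_Icc hN]
    ring

lemma tendsto_sum_range_of_gt (hp0 : 0 ≤ p) (hp1 : p ≤ 1) (hM : ∀ᶠ N in atTop, M N ≤ N)
    (hr : Tendsto (fun N => (M N : ℝ) / N) atTop (𝓝 r)) (hpr : p < r) :
    Tendsto (fun N => ∑ j ∈ range (M N), binomialWeight N p j) atTop (𝓝 1) ∧
    Tendsto (fun N : ℕ => ∑ j ∈ range (M N), (2 * (j : ℝ) / N - 1) * binomialWeight N p j)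
      atTop (𝓝 (2 * p - 1)) := by
  have hδ : 0 < (r - p) / 2 := by linarith
  have hs : ∀ᶠ N in atTop, Icc (M N) N ⊆ range (N + 1) :=
    .of_forall fun N j hj => mem_range_succ_iff.2 (mem_Icc.1 hj).2
  have hfar : ∀ᶠ N : ℕ in atTop, ∀ j ∈ Icc (M N) N, (r - p) / 2 * N ≤ |N * p - j| := by
    filter_upwards [hr.eventually_const_lt (show (p + r) / 2 < r by linarith),
      eventually_gt_atTop 0] with N h₁ h₂ j hj
    have hj' : (M N : ℝ) ≤ j := by exact_mod_cast (mem_Icc.1 hj).1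
    rw [lt_div_iff₀ (by exact_mod_cast h₂)] at h₁
    exact le_trans (by linarith) (neg_le_abs _)
  constructor
  · refine ((tendsto_sum_binomialWeight_of_far hp0 hp1 hδ hs hfar).const_sub 1).congr' ?_
      |>.trans_eq (by simp)
    filter_upwards [hM] with N hN
    rw [← sum_binomialWeight N p, ← sum_range_add_sum_Icc hN]
    ring
  · refine ((tendsto_sum_displacement_of_far hp0 hp1 hδ hs hfar).const_sub (2 * p - 1)).congr' ?_
      |>.trans_eq (by simp)
    filter_upwards [hM, eventually_ne_atTop 0] with N hN hN0
    rw [← sum_displacement_mul_binomialWeight hN0 p, ← sum_range_add_sum_Icc hN]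
    ring

end Concentration

/-- The weight of the states above the threshold relative to those below it. -/
noncomputable def tiltFactor (N M : ℕ) (p0 p1 : ℝ) : ℝ :=
  ((1 - p0) / (1 - p1)) ^ N / ((p1 / p0) * ((1 - p0) / (1 - p1))) ^ M

section Parameters

variable {p0 p1 : ℝ}

lemma odds_pow_mul_pow {p : ℝ} (hp : p < 1) {N j : ℕ} (hj : j ≤ N) :
    (p / (1 - p)) ^ j * (1 - p) ^ N = p ^ j * (1 - p) ^ (N - j) := by
  have : (1 - p) ≠ 0 := (sub_pos.2 hp).ne'
  rw [← Nat.sub_add_cancel hj, pow_add, Nat.add_sub_cancel, div_pow]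
  field_simp

lemma odds_pow_mul_odds_pow (h0 : 0 < p0) (h01 : p0 < p1) (h1 : p1 < 1) {N M j : ℕ}
    (hMj : M ≤ j) (hj : j ≤ N) :
    (p0 / (1 - p0)) ^ M * (p1 / (1 - p1)) ^ (j - M) * (1 - p0) ^ N
      = tiltFactor N M p0 p1 * (p1 ^ j * (1 - p1) ^ (N - j)) := by
  have hq0 : 1 - p0 ≠ 0 := by linarith
  have hq1 : 1 - p1 ≠ 0 := by linarith
  have hp1 : p1 ≠ 0 := by linarith
  have hp0 : p0 ≠ 0 := h0.ne'
  obtain ⟨k, rfl⟩ := Nat.exists_eq_add_of_le hMj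
  rw [← odds_pow_mul_pow h1 hj, Nat.add_sub_cancel_left, tiltFactor, pow_add]
  simp only [div_pow, mul_pow]
  field_simp

lemma speed1_eq_s2 (h0 : 0 < p0) (h01 : p0 < p1) (h1 : p1 < 1) {N M : ℕ} (hM : M ≤ N) :
    speed1 N M p0 p1 =
      (1 / (1 - p0) * ∑ j ∈ range M, (2 * (j : ℝ) / N - 1) * binomialWeight N p0 j
        + 1 / (1 - p1) * tiltFactor N M p0 p1 *
          ∑ j ∈ Icc M N, (2 * (j : ℝ) / N - 1) * binomialWeight N p1 j) /
      (1 / (1 - p0) * ∑ j ∈ range M, binomialWeight N p0 j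
        + 1 / (1 - p1) * tiltFactor N M p0 p1 * ∑ j ∈ Icc M N, binomialWeight N p1 j) := by
  have hq0 : (1 - p0) ^ N ≠ 0 := pow_ne_zero _ (by linarith)
  have key : ∀ g : ℕ → ℝ,
      (1 / (1 - p0) * ∑ j ∈ range M, g j * (N.choose j) * (p0 / (1 - p0)) ^ j
        + 1 / (1 - p1) * (p0 / (1 - p0)) ^ M *
          ∑ j ∈ Icc M N, g j * (N.choose j) * (p1 / (1 - p1)) ^ (j - M)) * (1 - p0) ^ N
      = 1 / (1 - p0) * ∑ j ∈ range M, g j * binomialWeight N p0 j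
        + 1 / (1 - p1) * tiltFactor N M p0 p1 *
          ∑ j ∈ Icc M N, g j * binomialWeight N p1 j := by
    intro g
    simp only [add_mul, mul_sum, sum_mul]
    congr 1 <;> refine sum_congr rfl fun j hj => ?_
    · have := odds_pow_mul_pow (h01.trans h1) ((mem_range.1 hj).le.trans hM)
      rw [binomialWeight]
      linear_combination 1 / (1 - p0) * g j * N.choose j * this
    · have := odds_pow_mul_odds_pow h0 h01 h1 (mem_Icc.1 hj).1 (mem_Icc.1 hj).2
      rw [binomialWeight]
      linear_combination 1 / (1 - p1) * g j * N.choose j * this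
  have key1 := key fun _ => 1
  simp only [one_mul] at key1
  rw [← key, ← key1, mul_div_mul_right _ _ hq0, speed1]

lemma tiltFactor_pos (h0 : 0 < p0) (h01 : p0 < p1) (h1 : p1 < 1) (N M : ℕ) :
    0 < tiltFactor N M p0 p1 := by
  have hq0 : 0 < 1 - p0 := by linarith
  have hq1 : 0 < 1 - p1 := by linarith
  have hp1 : 0 < p1 := h0.trans h01
  unfold tiltFactor
  positivity

lemma log_tiltFactor (h0 : 0 < p0) (h01 : p0 < p1) (h1 : p1 < 1) {N : ℕ} (hN : N ≠ 0) (M : ℕ) :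
    Real.log (tiltFactor N M p0 p1) =
      N * (Real.log ((1 - p0) / (1 - p1))
        - M / N * Real.log ((p1 / p0) * ((1 - p0) / (1 - p1)))) := by
  have hq0 : 0 < 1 - p0 := by linarith
  have hq1 : 0 < 1 - p1 := by linarith
  have hp1 : 0 < p1 := h0.trans h01
  have hN' : (N : ℝ) ≠ 0 := Nat.cast_ne_zero.2 hN
  rw [tiltFactor, Real.log_div (by positivity) (by positivity), Real.log_pow, Real.log_pow]
  field_simp

lemma log_odds_ratio_pos (h0 : 0 < p0) (h01 : p0 < p1) (h1 : p1 < 1) :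
    0 < Real.log ((p1 / p0) * ((1 - p0) / (1 - p1))) := by
  have hq1 : 0 < 1 - p1 := by linarith
  refine Real.log_pos (one_lt_mul_of_lt_of_le ?_ ?_)
  · rwa [one_lt_div h0]
  · rw [one_le_div hq1]
    linarith

lemma tendsto_log_tiltFactor_div (h0 : 0 < p0) (h01 : p0 < p1) (h1 : p1 < 1) {M : ℕ → ℕ} {r : ℝ}
    (hr : Tendsto (fun N => (M N : ℝ) / N) atTop (𝓝 r)) :
    Tendsto (fun N : ℕ => Real.log ((1 - p0) / (1 - p1))
        - (M N : ℝ) / N * Real.log ((p1 / p0) * ((1 - p0) / (1 - p1)))) atTop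
      (𝓝 ((rstar p0 p1 - r) * Real.log ((p1 / p0) * ((1 - p0) / (1 - p1))))) := by
  have h := (hr.mul_const (Real.log ((p1 / p0) * ((1 - p0) / (1 - p1))))).const_sub
    (Real.log ((1 - p0) / (1 - p1)))
  rwa [sub_mul, rstar, div_mul_cancel₀ _ (log_odds_ratio_pos h0 h01 h1).ne']

lemma tendsto_tiltFactor_atTop (h0 : 0 < p0) (h01 : p0 < p1) (h1 : p1 < 1) {M : ℕ → ℕ} {r : ℝ}
    (hr : Tendsto (fun N => (M N : ℝ) / N) atTop (𝓝 r)) (hlt : r < rstar p0 p1) :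
    Tendsto (fun N => tiltFactor N (M N) p0 p1) atTop atTop := by
  have h := (tendsto_natCast_atTop_atTop (R := ℝ)).atTop_mul_pos
    (mul_pos (sub_pos.2 hlt) (log_odds_ratio_pos h0 h01 h1))
    (tendsto_log_tiltFactor_div h0 h01 h1 hr)
  refine (Real.tendsto_exp_atTop.comp h).congr' ?_
  filter_upwards [eventually_ne_atTop 0] with N hN
  rw [Function.comp_apply, ← log_tiltFactor h0 h01 h1 hN,
    Real.exp_log (tiltFactor_pos h0 h01 h1 N _)]

lemma tendsto_tiltFactor_zero (h0 : 0 < p0) (h01 : p0 < p1) (h1 : p1 < 1) {M : ℕ → ℕ} {r : ℝ}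
    (hr : Tendsto (fun N => (M N : ℝ) / N) atTop (𝓝 r)) (hlt : rstar p0 p1 < r) :
    Tendsto (fun N => tiltFactor N (M N) p0 p1) atTop (𝓝 0) := by
  have h := (tendsto_natCast_atTop_atTop (R := ℝ)).atTop_mul_neg
    (mul_neg_of_neg_of_pos (sub_neg.2 hlt) (log_odds_ratio_pos h0 h01 h1))
    (tendsto_log_tiltFactor_div h0 h01 h1 hr)
  refine (Real.tendsto_exp_atBot.comp h).congr' ?_
  filter_upwards [eventually_ne_atTop 0] with N hN
  rw [Function.comp_apply, ← log_tiltFactor h0 h01 h1 hN,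
    Real.exp_log (tiltFactor_pos h0 h01 h1 N _)]

lemma sub_le_mul_log_div {x y : ℝ} (hx : 0 < x) (hy : 0 < y) :
    x - y ≤ x * Real.log (x / y) := by
  have h := mul_le_mul_of_nonneg_left (Real.one_sub_inv_le_log_of_pos (div_pos hx hy)) hx.le
  rwa [mul_sub, mul_one, inv_div, mul_div_cancel₀ _ hx.ne'] at h

lemma mul_log_div_lt_sub {x y : ℝ} (hx : 0 < x) (hy : 0 < y) (hxy : x ≠ y) :
    x * Real.log (y / x) < y - x := by
  have h := mul_lt_mul_of_pos_left (Real.log_lt_sub_one_of_pos (div_pos hy hx)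
    fun h => hxy ((div_eq_one_iff_eq hx.ne').1 h).symm) hx
  rwa [mul_sub, mul_one, mul_div_cancel₀ _ hx.ne'] at h

lemma rstar_lt (h0 : 0 < p0) (h01 : p0 < p1) (h1 : p1 < 1) : rstar p0 p1 < p1 := by
  have hq0 : 0 < 1 - p0 := by linarith
  have hq1 : 0 < 1 - p1 := by linarith
  have hp1 : 0 < p1 := h0.trans h01
  rw [rstar, div_lt_iff₀ (log_odds_ratio_pos h0 h01 h1),
    Real.log_mul (by positivity) (by positivity)]
  have h₁ := sub_le_mul_log_div hp1 h0
  have h₂ := mul_log_div_lt_sub hq1 hq0 (by linarith)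
  linarith

lemma lt_rstar (h0 : 0 < p0) (h01 : p0 < p1) (h1 : p1 < 1) : p0 < rstar p0 p1 := by
  have hq0 : 0 < 1 - p0 := by linarith
  have hq1 : 0 < 1 - p1 := by linarith
  have hp1 : 0 < p1 := h0.trans h01
  rw [rstar, lt_div_iff₀ (log_odds_ratio_pos h0 h01 h1),
    Real.log_mul (by positivity) (by positivity)]
  have h₁ := sub_le_mul_log_div hq0 hq1
  have h₂ := mul_log_div_lt_sub h0 hp1 h01.ne
  linarith

end Parameters

/-- Theorem 1.2 (main part): if `M_N / N → r` then the speed `s(N,M_N;p₀,p₁)`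
converges to `2p₁-1` when `r < r*(p₀,p₁)` and to `2p₀-1` when `r > r*(p₀,p₁)`. -/
theorem limit_speed_single_threshold (p0 p1 : ℝ)
    (h0 : 0 < p0) (h01 : p0 < p1) (h1 : p1 < 1)
    (M : ℕ → ℕ) (hM : ∀ N, 1 ≤ N → 1 ≤ M N ∧ M N ≤ N)
    (r : ℝ) (hr : Tendsto (fun N => (M N : ℝ) / N) atTop (𝓝 r)) :
    (0 ≤ r → r < rstar p0 p1 →
      Tendsto (fun N => speed1 N (M N) p0 p1) atTop (𝓝 (2 * p1 - 1))) ∧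
    (rstar p0 p1 < r → r ≤ 1 →
      Tendsto (fun N => speed1 N (M N) p0 p1) atTop (𝓝 (2 * p0 - 1))) := by
  have hM' : ∀ᶠ N in atTop, M N ≤ N := by
    filter_upwards [eventually_ge_atTop 1] with N hN using (hM N hN).2
  have hp0 : p0 ≤ 1 := (h01.trans h1).le
  have hp1 : 0 ≤ p1 := (h0.trans h01).le
  have hq0 : 1 / (1 - p0) ≠ 0 := one_div_ne_zero (by linarith)
  have hq1 : 1 / (1 - p1) ≠ 0 := one_div_ne_zero (by linarith)
  have bound : ∀ {t : ℕ → ℝ} {p : ℝ} {s : ℕ → Finset ℕ} {g : ℕ → ℕ → ℝ},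
      Tendsto t atTop (𝓝 0) → 0 ≤ p → p ≤ 1 → (∀ᶠ N in atTop, s N ⊆ range (N + 1)) →
      (∀ N j, j ≤ N → |g N j| ≤ 1) →
      Tendsto (fun N => t N * ∑ j ∈ s N, g N j * binomialWeight N p j) atTop (𝓝 0) := by
    intro t p s g ht hp hp' hs hg
    refine ht.zero_mul_isBoundedUnder_le ⟨1, eventually_map.2 ?_⟩
    filter_upwards [hs] with N hN
    exact (abs_sum_mul_binomialWeight_le hp hp' fun j hj =>
      hg N j (mem_range_succ_iff.1 (hN hj))).trans (sum_binomialWeight_le_one hp hp' hN)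
  have hdisp : ∀ N j : ℕ, j ≤ N → |2 * (j : ℝ) / N - 1| ≤ 1 :=
    fun _ _ => abs_displacement_le_one
  have hone : ∀ N j : ℕ, j ≤ N → |(1 : ℝ)| ≤ 1 := by simp
  constructor
  · intro _ hlt
    have hK := (tendsto_tiltFactor_atTop h0 h01 h1 hr hlt).inv_tendsto_atTop
    have hs : ∀ᶠ N in atTop, range (M N) ⊆ range (N + 1) := by
      filter_upwards [hM'] with N hN using range_subset_range.2 (by omega)
    obtain ⟨hmass, hmean⟩ := tendsto_sum_Icc_of_lt hp1 h1.le hM' hr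
      (hlt.trans (rstar_lt h0 h01 h1))
    have hnum := ((bound hK h0.le hp0 hs hdisp).const_mul (1 / (1 - p0))).add
      (hmean.const_mul (1 / (1 - p1)))
    have hden := ((bound hK h0.le hp0 hs hone).const_mul (1 / (1 - p0))).add
      (hmass.const_mul (1 / (1 - p1)))
    have hlim := hnum.div hden (by simpa using hq1)
    rw [mul_zero, zero_add, zero_add, mul_one, mul_div_cancel_left₀ _ hq1] at hlim
    refine hlim.congr' ?_
    filter_upwards [hM'] with N hN
    have hne := (tiltFactor_pos h0 h01 h1 N (M N)).ne'
    rw [speed1_eq_s2 h0 h01 h1 hN]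
    conv_rhs => rw [← mul_div_mul_left _ _ (inv_ne_zero hne)]
    simp only [Pi.div_apply, Pi.inv_apply, one_mul]
    congr 1 <;> field_simp
  · intro hlt _
    have hK := tendsto_tiltFactor_zero h0 h01 h1 hr hlt
    have hs : ∀ᶠ N in atTop, Icc (M N) N ⊆ range (N + 1) :=
      .of_forall fun N j hj => mem_range_succ_iff.2 (mem_Icc.1 hj).2
    obtain ⟨hmass, hmean⟩ := tendsto_sum_range_of_gt h0.le hp0 hM' hr
      ((lt_rstar h0 h01 h1).trans hlt)
    have hnum := (hmean.const_mul (1 / (1 - p0))).add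
      ((bound hK hp1 h1.le hs hdisp).const_mul (1 / (1 - p1)))
    have hden := (hmass.const_mul (1 / (1 - p0))).add
      ((bound hK hp1 h1.le hs hone).const_mul (1 / (1 - p1)))
    have hlim := hnum.div hden (by simpa using hq0)
    rw [mul_zero, add_zero, add_zero, mul_one, mul_div_cancel_left₀ _ hq0] at hlim
    refine hlim.congr' ?_
    filter_upwards [hM'] with N hN
    rw [speed1_eq_s2 h0 h01 h1 hN]
    simp only [Pi.div_apply, one_mul, mul_assoc]
end

section
/- The function r*(p0,p1) = log((1−p0)/(1−p1)) / log( (p1/p0)·((1−p0)/(1−p1)) ), defined for 0 < p0 < p1 < 1, is strictly monotone increasing in p0 (for fixed p1) and strictly monotone increasing in p1 (for fixed p0), and satisfies p0 < r*(p0,p1) < p1 for all 0 < p0 < p1 < 1. -/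
theorem mul_log_sub_log_lt {x y : ℝ} (hx : 0 < x) (hxy : x < y) :
    x * (Real.log y - Real.log x) < y - x := by
  have hy : 0 < y := hx.trans hxy
  have h := Real.log_lt_sub_one_of_pos (div_pos hy hx) (by
    rw [Ne, div_eq_one_iff_eq hx.ne']; exact hxy.ne')
  rw [Real.log_div hy.ne' hx.ne'] at h
  calc x * (Real.log y - Real.log x) < x * (y / x - 1) := mul_lt_mul_of_pos_left h hx
    _ = y - x := by field_simp

theorem sub_lt_mul_log_sub_log {x y : ℝ} (hx : 0 < x) (hxy : x < y) :
    y - x < y * (Real.log y - Real.log x) := by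
  have hy : 0 < y := hx.trans hxy
  have h := Real.log_lt_sub_one_of_pos (div_pos hx hy) (by
    rw [Ne, div_eq_one_iff_eq hy.ne']; exact hxy.ne)
  rw [Real.log_div hx.ne' hy.ne'] at h
  have h' : y * (Real.log x - Real.log y) < y * (x / y - 1) := mul_lt_mul_of_pos_left h hy
  have h'' : y * (x / y - 1) = x - y := by field_simp
  linarith

theorem rstar_eq {p q : ℝ} (hp : 0 < p) (hpq : p < q) (hq : q < 1) :
    rstar p q = (Real.log (1 - p) - Real.log (1 - q)) /
      ((Real.log q - Real.log p) + (Real.log (1 - p) - Real.log (1 - q))) := by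
  have hq0 : q ≠ 0 := (hp.trans hpq).ne'
  have hp1 : 1 - p ≠ 0 := (sub_pos.2 (hpq.trans hq)).ne'
  have hq1 : 1 - q ≠ 0 := (sub_pos.2 hq).ne'
  rw [rstar, Real.log_mul (div_ne_zero hq0 hp.ne') (div_ne_zero hp1 hq1),
    Real.log_div hq0 hp.ne', Real.log_div hp1 hq1]

theorem rstar_denom_pos {p q : ℝ} (hp : 0 < p) (hpq : p < q) (hq : q < 1) :
    0 < (Real.log q - Real.log p) + (Real.log (1 - p) - Real.log (1 - q)) := by
  have h₁ := Real.log_lt_log hp hpq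
  have h₂ := Real.log_lt_log (sub_pos.2 hq) (sub_lt_sub_left hpq 1)
  linarith

theorem rstar_mem_Ioo {p q : ℝ} (hp : 0 < p) (hpq : p < q) (hq : q < 1) :
    rstar p q ∈ Set.Ioo p q := by
  have hd := rstar_denom_pos hp hpq hq
  have hq' : 0 < 1 - q := sub_pos.2 hq
  have hpq' : 1 - q < 1 - p := sub_lt_sub_left hpq 1
  rw [rstar_eq hp hpq hq, Set.mem_Ioo, lt_div_iff₀ hd, div_lt_iff₀ hd]
  have h₁ := mul_log_sub_log_lt hp hpq
  have h₂ := sub_lt_mul_log_sub_log hp hpq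
  have h₃ := mul_log_sub_log_lt hq' hpq'
  have h₄ := sub_lt_mul_log_sub_log hq' hpq'
  constructor <;> linarith

theorem mediant_mem_Ioo {a b c d : ℝ} (hb : 0 < b) (hd : 0 < d) (h : a / b < c / d) :
    (a + c) / (b + d) ∈ Set.Ioo (a / b) (c / d) := by
  have hbd : 0 < b + d := add_pos hb hd
  rw [div_lt_div_iff₀ hb hd] at h
  rw [Set.mem_Ioo, div_lt_div_iff₀ hb hbd, div_lt_div_iff₀ hbd hd]
  constructor <;> linarith

/-- `rstar p s` is a mediant of `rstar p q` and `rstar q s`, which are separated by `q`. -/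
theorem rstar_mem_Ioo_rstar {p q s : ℝ} (hp : 0 < p) (hpq : p < q) (hqs : q < s) (hs : s < 1) :
    rstar p s ∈ Set.Ioo (rstar p q) (rstar q s) := by
  have hq : 0 < q := hp.trans hpq
  have hq1 : q < 1 := hqs.trans hs
  have h : rstar p q < rstar q s :=
    (rstar_mem_Ioo hp hpq hq1).2.trans (rstar_mem_Ioo hq hqs hs).1
  rw [rstar_eq hp hpq hq1, rstar_eq hq hqs hs] at h ⊢
  rw [rstar_eq hp (hpq.trans hqs) hs]
  convert mediant_mem_Ioo (rstar_denom_pos hp hpq hq1) (rstar_denom_pos hq hqs hs) h using 2 <;>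
    ring

/-- `r*(p₀,p₁)` is strictly increasing in each variable (for `0 < p₀ < p₁ < 1`),
and satisfies `p₀ < r*(p₀,p₁) < p₁`. -/
theorem rstar_monotone_and_between :
    (∀ p0 p0' p1 : ℝ, 0 < p0 → p0 < p0' → p0' < p1 → p1 < 1 →
      rstar p0 p1 < rstar p0' p1) ∧
    (∀ p0 p1 p1' : ℝ, 0 < p0 → p0 < p1 → p1 < p1' → p1' < 1 →
      rstar p0 p1 < rstar p0 p1') ∧
    (∀ p0 p1 : ℝ, 0 < p0 → p0 < p1 → p1 < 1 →
      p0 < rstar p0 p1 ∧ rstar p0 p1 < p1) := by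
  exact ⟨fun _ _ _ h₀ h₁ h₂ h₃ => (rstar_mem_Ioo_rstar h₀ h₁ h₂ h₃).2,
    fun _ _ _ h₀ h₁ h₂ h₃ => (rstar_mem_Ioo_rstar h₀ h₁ h₂ h₃).1,
    fun _ _ h₀ h₁ h₂ => rstar_mem_Ioo h₀ h₁ h₂⟩
end

section
/- Consider the Markov chain {Z_n} on H_N = {−1,1}^N whose transition from a state w = (w_1,…,w_N) moves to (w_2,…,w_N, 1) with probability p_i and to (w_2,…,w_N, −1) with probability 1 − p_i, where i ∈ {0,…,l} is the index with M_i ≤ #^+(w) < M_{i+1} and #^+(w) = #{j : w_j = 1}. Then the probability measure μ_Z on H_N defined by μ_Z(v) = C · (1/(1−p_i)) · (p_i/(1−p_i))^{#^+(v) − M_i} · ∏_{k=1}^{i} (p_{k−1}/(1−p_{k−1}))^{M_k − M_{k−1}} whenever M_i ≤ #^+(v) < M_{i+1}, with C the normalizing constant making the total mass 1, is an invariant (stationary) probability measure for the chain. -/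
open Finset

/-- The index `i` of the threshold stage corresponding to `c` right-jumps:
the largest `i ∈ {0,…,l}` with `M i ≤ c` (so that, when `M` is increasing with
`M 0 = 0`, it is the unique `i` with `M i ≤ c < M (i+1)`). -/
def stage (l : ℕ) (M : ℕ → ℕ) (c : ℕ) : ℕ :=
  ((Finset.range (l + 1)).filter (fun i => M i ≤ c)).sup id

/-- The number `#⁺(v)` of `+1`-entries of a state `v ∈ H_N = {-1,1}^N`,
encoded as `v : Fin N → Bool` with `true` standing for `+1`. -/
def countPlus (N : ℕ) (v : Fin N → Bool) : ℕ :=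
  (Finset.univ.filter (fun j => v j = true)).card

/-- The state obtained from `w` by dropping its first coordinate and appending the
entry `b` at the end: the chain moves from `w = (w₁,…,w_N)` to `(w₂,…,w_N, b)`. -/
def shiftApp (N : ℕ) (w : Fin N → Bool) (b : Bool) : Fin N → Bool :=
  fun j => if h : (j : ℕ) + 1 < N then w ⟨(j : ℕ) + 1, h⟩ else b

/-- The transition matrix of the auxiliary Markov chain on `H_N = {-1,1}^N`: from
`w` the chain moves to `(w₂,…,w_N, +1)` with probability `p i` and to
`(w₂,…,w_N, -1)` with probability `1 - p i`, where `i` is the stage index with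
`M i ≤ #⁺(w) < M (i+1)`. -/
noncomputable def transMat (N l : ℕ) (M : ℕ → ℕ) (p : ℕ → ℝ)
    (w v : Fin N → Bool) : ℝ :=
  (if shiftApp N w true = v then p (stage l M (countPlus N w)) else 0) +
  (if shiftApp N w false = v then 1 - p (stage l M (countPlus N w)) else 0)

/-- The unnormalized invariant density: for `M i ≤ #⁺(v) < M (i+1)` it equals
`(1/(1-pᵢ)) (pᵢ/(1-pᵢ))^(#⁺(v) - Mᵢ) ∏_{k=1}^{i} (p_{k-1}/(1-p_{k-1}))^(M_k - M_{k-1})`. -/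
noncomputable def muUnnorm (N l : ℕ) (M : ℕ → ℕ) (p : ℕ → ℝ)
    (v : Fin N → Bool) : ℝ :=
  (1 / (1 - p (stage l M (countPlus N v)))) *
    (p (stage l M (countPlus N v)) / (1 - p (stage l M (countPlus N v)))) ^
      (countPlus N v - M (stage l M (countPlus N v))) *
    ∏ k ∈ Finset.Icc 1 (stage l M (countPlus N v)),
      (p (k - 1) / (1 - p (k - 1))) ^ (M k - M (k - 1))

lemma stage_le (l : ℕ) (M : ℕ → ℕ) (c : ℕ) : stage l M c ≤ l := by
  refine Finset.sup_le fun i hi => ?_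
  simp only [Finset.mem_filter, Finset.mem_range] at hi
  exact Nat.lt_succ_iff.mp hi.1

lemma le_stage {l : ℕ} {M : ℕ → ℕ} {c i : ℕ} (hi : i ≤ l) (hc : M i ≤ c) :
    i ≤ stage l M c :=
  Finset.le_sup (f := id) (by simp only [Finset.mem_filter, Finset.mem_range]; omega)

lemma apply_stage_le {l : ℕ} {M : ℕ → ℕ} (hM0 : M 0 = 0) (c : ℕ) :
    M (stage l M c) ≤ c := by
  have hne : ((Finset.range (l + 1)).filter (fun i => M i ≤ c)).Nonempty :=
    ⟨0, by simp [hM0]⟩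
  obtain ⟨i, hi, h⟩ := Finset.exists_mem_eq_sup _ hne id
  have hs : stage l M c = i := h
  rw [hs]
  exact (Finset.mem_filter.mp hi).2

lemma stage_mono {l : ℕ} {M : ℕ → ℕ} {c d : ℕ} (hM0 : M 0 = 0) (h : c ≤ d) :
    stage l M c ≤ stage l M d :=
  le_stage (stage_le l M c) ((apply_stage_le hM0 c).trans h)

lemma stage_succ_cases {l : ℕ} {M : ℕ → ℕ} (hM0 : M 0 = 0)
    (hM : ∀ i < l, M i < M (i + 1)) (c : ℕ) :
    stage l M (c + 1) = stage l M c ∨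
      (stage l M (c + 1) = stage l M c + 1 ∧ M (stage l M c + 1) = c + 1) := by
  have hmono : stage l M c ≤ stage l M (c + 1) := stage_mono hM0 (Nat.le_succ c)
  have hl := stage_le l M (c + 1)
  have hle := apply_stage_le (l := l) hM0 (c + 1)
  rcases hmono.eq_or_lt with h | h
  · exact Or.inl h.symm
  · right
    obtain ⟨j, hj⟩ : ∃ j, stage l M (c + 1) = j + 1 := ⟨stage l M (c + 1) - 1, by omega⟩
    rw [hj] at h
    rw [hj] at hl hle
    have hj_le : j ≤ stage l M c :=
      le_stage (by omega) (by have := hM j (by omega); omega)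
    have hj_eq : stage l M c = j := by omega
    refine ⟨by omega, ?_⟩
    rw [hj_eq]
    by_contra hne
    have := le_stage (l := l) (M := M) (c := c) (i := j + 1) hl (by omega)
    omega

/-- The value of the unnormalized invariant density on states with `c` entries `+1`. -/
noncomputable def densityOfCount (l : ℕ) (M : ℕ → ℕ) (p : ℕ → ℝ) (c : ℕ) : ℝ :=
  (1 / (1 - p (stage l M c))) *
    (p (stage l M c) / (1 - p (stage l M c))) ^ (c - M (stage l M c)) *
    ∏ k ∈ Finset.Icc 1 (stage l M c), (p (k - 1) / (1 - p (k - 1))) ^ (M k - M (k - 1))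

lemma muUnnorm_eq_densityOfCount (N l : ℕ) (M : ℕ → ℕ) (p : ℕ → ℝ) (v : Fin N → Bool) :
    muUnnorm N l M p v = densityOfCount l M p (countPlus N v) := rfl

lemma densityOfCount_pos {l : ℕ} {M : ℕ → ℕ} {p : ℕ → ℝ}
    (hp0 : ∀ i ≤ l, 0 < p i) (hp1 : ∀ i ≤ l, p i < 1) (c : ℕ) :
    0 < densityOfCount l M p c := by
  have hl := stage_le l M c
  have h1 : ∀ i ≤ l, 0 < 1 - p i := fun i hi => sub_pos.mpr (hp1 i hi)
  refine mul_pos (mul_pos (one_div_pos.mpr (h1 _ hl))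
    (pow_pos (div_pos (hp0 _ hl) (h1 _ hl)) _)) (Finset.prod_pos fun k hk => ?_)
  have hk' : k - 1 ≤ l := by have := Finset.mem_Icc.mp hk; omega
  exact pow_pos (div_pos (hp0 _ hk') (h1 _ hk')) _

/-- Detailed balance for the number of `+1` entries. -/
lemma densityOfCount_succ {l : ℕ} {M : ℕ → ℕ} {p : ℕ → ℝ} (hM0 : M 0 = 0)
    (hM : ∀ i < l, M i < M (i + 1)) (hp1 : ∀ i ≤ l, p i < 1) (c : ℕ) :
    densityOfCount l M p (c + 1) * (1 - p (stage l M (c + 1))) =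
      densityOfCount l M p c * p (stage l M c) := by
  have hne : 1 - p (stage l M c) ≠ 0 := (sub_pos.mpr (hp1 _ (stage_le l M c))).ne'
  have hne' : 1 - p (stage l M (c + 1)) ≠ 0 :=
    (sub_pos.mpr (hp1 _ (stage_le l M (c + 1)))).ne'
  have hle := apply_stage_le (l := l) hM0 c
  unfold densityOfCount
  rcases stage_succ_cases hM0 hM c with h | ⟨h, hMc⟩
  · rw [h, Nat.sub_add_comm hle, pow_succ]
    field_simp
  · rw [h] at hne' ⊢
    rw [hMc, Nat.sub_self, pow_zero, Finset.prod_Icc_succ_top (by omega), hMc,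
      Nat.add_sub_cancel, Nat.sub_add_comm hle, pow_succ]
    field_simp

lemma countPlus_cons {n : ℕ} (b : Bool) (u : Fin n → Bool) :
    countPlus (n + 1) (Fin.cons b u) = countPlus n u + b.toNat := by
  simp only [countPlus, Finset.card_filter, Fin.sum_univ_succ, Fin.cons_zero, Fin.cons_succ]
  cases b <;> simp [add_comm]

lemma countPlus_snoc {n : ℕ} (u : Fin n → Bool) (b : Bool) :
    countPlus (n + 1) (Fin.snoc u b : Fin (n + 1) → Bool) = countPlus n u + b.toNat := by
  simp only [countPlus, Finset.card_filter, Fin.sum_univ_castSucc, Fin.snoc_castSucc,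
    Fin.snoc_last]
  cases b <;> simp

lemma shiftApp_cons {n : ℕ} (a b : Bool) (u : Fin n → Bool) :
    shiftApp (n + 1) (Fin.cons a u) b = (Fin.snoc u b : Fin (n + 1) → Bool) := by
  funext j
  refine Fin.lastCases ?_ (fun i => ?_) j
  · simp [shiftApp]
  · have hi : ((i.castSucc : Fin (n + 1)) : ℕ) + 1 < n + 1 := by simp
    rw [Fin.snoc_castSucc, shiftApp, dif_pos hi]
    exact Fin.cons_succ (α := fun _ => Bool) a u i

lemma sum_eq_sum_cons {n : ℕ} (F : (Fin (n + 1) → Bool) → ℝ) :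
    ∑ w, F w = ∑ u : Fin n → Bool, (F (Fin.cons true u) + F (Fin.cons false u)) := by
  rw [← (Fin.consEquiv fun _ : Fin (n + 1) => Bool).sum_comp, Fintype.sum_prod_type,
    Fintype.sum_bool, ← Finset.sum_add_distrib]
  rfl

lemma sum_muUnnorm_mul_transMat {n l : ℕ} {M : ℕ → ℕ} {p : ℕ → ℝ} (hM0 : M 0 = 0)
    (hM : ∀ i < l, M i < M (i + 1)) (hp1 : ∀ i ≤ l, p i < 1) (v : Fin (n + 1) → Bool) :
    ∑ w, muUnnorm (n + 1) l M p w * transMat (n + 1) l M p w v =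
      muUnnorm (n + 1) l M p v := by
  obtain ⟨u, b, rfl⟩ : ∃ (u : Fin n → Bool) (b : Bool), v = Fin.snoc u b :=
    ⟨Fin.init v, v (Fin.last n), (Fin.snoc_init_self v).symm⟩
  have hstep := densityOfCount_succ hM0 hM hp1 (countPlus n u)
  rw [sum_eq_sum_cons, Finset.sum_eq_single u]
  · cases b <;>
      simp only [transMat, shiftApp_cons, muUnnorm_eq_densityOfCount, countPlus_cons,
        countPlus_snoc, Fin.snoc_inj, Bool.toNat_true, Bool.toNat_false, add_zero, zero_add,
        true_and, if_true, if_false, reduceCtorEq] <;>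
      linarith
  · intro u' _ hu
    simp [transMat, shiftApp_cons, Fin.snoc_inj, hu]
  · simp

/-- Proposition 2.1: the probability measure `μ_Z(v) = C · muUnnorm v`, with `C` the
normalizing constant, is invariant for the auxiliary Markov chain on `{-1,1}^N`. -/
theorem invariant_measure_of_auxiliary_chain (l N : ℕ) (hl : 1 ≤ l) (hlN : l ≤ N)
    (M : ℕ → ℕ) (hM0 : M 0 = 0) (hM1 : 1 ≤ M 1)
    (hMmono : ∀ i, 1 ≤ i → i < l → M i < M (i + 1)) (hMl : M l ≤ N)
    (hMtop : M (l + 1) = N + 1)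
    (p : ℕ → ℝ) (hp0 : 0 < p 0) (hpmono : ∀ i < l, p i < p (i + 1)) (hpl : p l < 1) :
    ∃ C : ℝ, 0 < C ∧
      (∑ v : Fin N → Bool, C * muUnnorm N l M p v) = 1 ∧
      ∀ v : Fin N → Bool,
        (∑ w : Fin N → Bool, (C * muUnnorm N l M p w) * transMat N l M p w v) =
          C * muUnnorm N l M p v := by
  obtain ⟨n, rfl⟩ : ∃ n, N = n + 1 := ⟨N - 1, by omega⟩
  have hM : ∀ i < l, M i < M (i + 1) := by
    intro i hi
    rcases Nat.eq_zero_or_pos i with rfl | h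
    · rw [hM0]; exact hM1
    · exact hMmono i h hi
  have hpos : ∀ i ≤ l, 0 < p i := by
    intro i
    induction i with
    | zero => exact fun _ => hp0
    | succ k ih => exact fun h => (ih (by omega)).trans (hpmono k h)
  have hlt : ∀ i ≤ l, p i < 1 := fun i hi =>
    Nat.decreasingInduction (motive := fun i _ => p i < 1)
      (fun k hk h => (hpmono k hk).trans h) hpl hi
  have hS : 0 < ∑ v : Fin (n + 1) → Bool, muUnnorm (n + 1) l M p v :=
    Finset.sum_pos (fun v _ => densityOfCount_pos hpos hlt _) Finset.univ_nonempty
  refine ⟨(∑ v : Fin (n + 1) → Bool, muUnnorm (n + 1) l M p v)⁻¹, inv_pos.mpr hS, ?_,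
    fun v => ?_⟩
  · rw [← Finset.mul_sum, inv_mul_cancel₀ hS.ne']
  · simp only [mul_assoc]
    rw [← Finset.mul_sum, sum_muUnnorm_mul_transMat hM0 hM hlt]
end

section
/- Let l ≥ 1, let 0 < p_0 < ⋯ < p_l < 1, let r_1 ≤ ⋯ ≤ r_l be reals in [0,1] with r_0 = 0 and r_{l+1} = 1, and suppose that the maximum over i ∈ {0,…,l} with r_i < p_i < r_{i+1} of J_i := (1/( p_i^{r_i} (1−p_i)^{1−r_i} )) ∏_{k=1}^{i} (p_{k−1}/(1−p_{k−1}))^{r_k − r_{k−1}} is attained at a unique index i_0. Then for any sequences of integer thresholds M_1 < ⋯ < M_l (depending on N) with M_i/N → r_i for each i, lim_{N→∞} s(N,M_1,…,M_l;p_0,…,p_l) = 2 p_{i_0} − 1. -/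
open Filter Finset Topology

/-- The explicit multi-stage speed formula `s(N,M₁,…,M_l;p₀,…,p_l)`. -/
noncomputable def speedMulti (N l : ℕ) (M : ℕ → ℕ) (p : ℕ → ℝ) : ℝ :=
  (∑ i ∈ Finset.range (l + 1), (1 / (1 - p i)) *
      (∏ k ∈ Finset.Icc 1 i, (p (k - 1) / (1 - p (k - 1))) ^ (M k - M (k - 1))) *
      ∑ j ∈ Finset.Ico (M i) (M (i + 1)),
        (2 * (j : ℝ) / N - 1) * (N.choose j) * (p i / (1 - p i)) ^ (j - M i)) /
  (∑ i ∈ Finset.range (l + 1), (1 / (1 - p i)) *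
      (∏ k ∈ Finset.Icc 1 i, (p (k - 1) / (1 - p (k - 1))) ^ (M k - M (k - 1))) *
      ∑ j ∈ Finset.Ico (M i) (M (i + 1)),
        ((N.choose j : ℝ)) * (p i / (1 - p i)) ^ (j - M i))

/-- The quantity `J_i = (1/(pᵢ^{rᵢ}(1-pᵢ)^{1-rᵢ})) ∏_{k=1}^{i} (p_{k-1}/(1-p_{k-1}))^{r_k - r_{k-1}}`. -/
noncomputable def Jfun (p r : ℕ → ℝ) (i : ℕ) : ℝ :=
  (1 / (p i ^ (r i) * (1 - p i) ^ (1 - r i))) *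
    ∏ k ∈ Finset.Icc 1 i, (p (k - 1) / (1 - p (k - 1))) ^ (r k - r (k - 1))

/-- The log-likelihood `r log x + (1 - r) log (1 - x)` is strictly increasing in `x` below `r`. -/
lemma logLikelihood_lt_of_lt_of_le {a b r : ℝ} (ha : 0 < a) (hab : a < b) (hb : b < 1)
    (hbr : b ≤ r) (hr : r ≤ 1) :
    r * Real.log a + (1 - r) * Real.log (1 - a) < r * Real.log b + (1 - r) * Real.log (1 - b) := by
  have hb0 : 0 < b := ha.trans hab
  have hb1 : 0 < 1 - b := by linarith
  have ha1 : 0 < 1 - a := by linarith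
  have h1 : Real.log a - Real.log b < a / b - 1 := by
    rw [← Real.log_div ha.ne' hb0.ne']
    refine Real.log_lt_sub_one_of_pos (div_pos ha hb0) ?_
    rw [Ne, div_eq_one_iff_eq hb0.ne']
    exact hab.ne
  have h2 : Real.log (1 - a) - Real.log (1 - b) ≤ (1 - a) / (1 - b) - 1 := by
    rw [← Real.log_div ha1.ne' hb1.ne']
    exact Real.log_le_sub_one_of_pos (div_pos ha1 hb1)
  have h3 := mul_lt_mul_of_pos_left h1 (hb0.trans_le hbr)
  have h4 := mul_le_mul_of_nonneg_left h2 (sub_nonneg.2 hr)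
  have h5 : r * (a / b - 1) + (1 - r) * ((1 - a) / (1 - b) - 1)
      = (a - b) * (r - b) / (b * (1 - b)) := by
    field_simp
    ring
  have h6 : (a - b) * (r - b) / (b * (1 - b)) ≤ 0 :=
    div_nonpos_of_nonpos_of_nonneg
      (mul_nonpos_of_nonpos_of_nonneg (by linarith) (by linarith)) (by positivity)
  linarith

/-- The log-likelihood `r log x + (1 - r) log (1 - x)` is strictly decreasing in `x` above `r`. -/
lemma logLikelihood_lt_of_le_of_lt {a b r : ℝ} (ha : 0 < a) (hab : a < b) (hb : b < 1)
    (hra : r ≤ a) (hr : 0 ≤ r) :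
    r * Real.log b + (1 - r) * Real.log (1 - b) < r * Real.log a + (1 - r) * Real.log (1 - a) := by
  have h := logLikelihood_lt_of_lt_of_le (a := 1 - b) (b := 1 - a) (r := 1 - r)
    (by linarith) (by linarith) (by linarith) (by linarith) (by linarith)
  simp only [sub_sub_cancel] at h
  linarith

lemma Jfun_pos {p r : ℕ → ℝ} {i : ℕ} (hp : ∀ k ≤ i, 0 < p k ∧ p k < 1) : 0 < Jfun p r i := by
  have h0 := (hp i le_rfl).1
  have h1 : 0 < 1 - p i := by linarith [(hp i le_rfl).2]
  refine mul_pos (by positivity) (Finset.prod_pos fun k hk => ?_)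
  rw [Finset.mem_Icc] at hk
  have hk' := hp (k - 1) (by omega)
  exact Real.rpow_pos_of_pos (div_pos hk'.1 (by linarith)) _

lemma log_Jfun {p r : ℕ → ℝ} {i : ℕ} (hp : ∀ k ≤ i, 0 < p k ∧ p k < 1) :
    Real.log (Jfun p r i) =
      -(r i * Real.log (p i) + (1 - r i) * Real.log (1 - p i)) +
        ∑ k ∈ Finset.Icc 1 i, (r k - r (k - 1)) * Real.log (p (k - 1) / (1 - p (k - 1))) := by
  have h0 := (hp i le_rfl).1
  have h1 : 0 < 1 - p i := by linarith [(hp i le_rfl).2]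
  have hρ : ∀ k ∈ Finset.Icc 1 i, 0 < p (k - 1) / (1 - p (k - 1)) := fun k hk => by
    rw [Finset.mem_Icc] at hk
    have hk' := hp (k - 1) (by omega)
    exact div_pos hk'.1 (by linarith)
  unfold Jfun
  rw [Real.log_mul (by positivity)
      (Finset.prod_pos fun k hk => Real.rpow_pos_of_pos (hρ k hk) _).ne',
    one_div, Real.log_inv, Real.log_mul (by positivity) (by positivity), Real.log_rpow h0,
    Real.log_rpow h1, Real.log_prod fun k hk => (Real.rpow_pos_of_pos (hρ k hk) _).ne']
  congr 1
  exact Finset.sum_congr rfl fun k hk => Real.log_rpow (hρ k hk) _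

lemma log_Jfun_succ_sub {p r : ℕ → ℝ} {i : ℕ} (hp : ∀ k ≤ i + 1, 0 < p k ∧ p k < 1) :
    Real.log (Jfun p r (i + 1)) - Real.log (Jfun p r i) =
      (r (i + 1) * Real.log (p i) + (1 - r (i + 1)) * Real.log (1 - p i)) -
        (r (i + 1) * Real.log (p (i + 1)) + (1 - r (i + 1)) * Real.log (1 - p (i + 1))) := by
  have h0 := hp i (by omega)
  rw [log_Jfun hp, log_Jfun fun k hk => hp k (by omega),
    Finset.sum_Icc_succ_top (by omega : 1 ≤ i + 1), Nat.add_sub_cancel,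
    Real.log_div h0.1.ne' (by linarith)]
  ring

/-- An index maximizing `J` over all stages is automatically admissible. -/
lemma lt_and_lt_of_Jfun_le {l : ℕ} {p r : ℕ → ℝ} (hp : ∀ k ≤ l, 0 < p k ∧ p k < 1)
    (hpmono : ∀ i < l, p i < p (i + 1)) (hr0 : r 0 = 0) (hrtop : r (l + 1) = 1)
    (hrmem : ∀ i, 1 ≤ i → i ≤ l → r i ∈ Set.Icc (0 : ℝ) 1) {i : ℕ} (hi : i ≤ l)
    (hmax : ∀ k ≤ l, Jfun p r k ≤ Jfun p r i) : r i < p i ∧ p i < r (i + 1) := by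
  have hlog : ∀ k ≤ l, Real.log (Jfun p r k) ≤ Real.log (Jfun p r i) := fun k hk =>
    Real.log_le_log (Jfun_pos fun m hm => hp m (hm.trans hk)) (hmax k hk)
  constructor
  · by_contra! h
    obtain _ | n := i
    · linarith [(hp 0 (Nat.zero_le _)).1]
    · have h1 := log_Jfun_succ_sub (r := r) (i := n) fun k hk => hp k (hk.trans hi)
      have h2 := logLikelihood_lt_of_lt_of_le (hp n (by omega)).1 (hpmono n (by omega))
        (hp (n + 1) hi).2 h (hrmem _ (by omega) hi).2
      linarith [hlog n (by omega)]
  · by_contra! h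
    rcases hi.eq_or_lt with rfl | hil
    · linarith [(hp i le_rfl).2]
    · have h1 := log_Jfun_succ_sub (r := r) (i := i) fun k hk => hp k (hk.trans hil)
      have h2 := logLikelihood_lt_of_le_of_lt (hp i hi).1 (hpmono i hil)
        (hp (i + 1) hil).2 h (hrmem _ (by omega) hil).1
      linarith [hlog (i + 1) hil]

/-- A strict maximizer of `J` among the admissible indices is a strict maximizer among all
indices. -/
lemma Jfun_lt_of_ne {l : ℕ} {p r : ℕ → ℝ} (hp : ∀ k ≤ l, 0 < p k ∧ p k < 1)
    (hpmono : ∀ i < l, p i < p (i + 1)) (hr0 : r 0 = 0) (hrtop : r (l + 1) = 1)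
    (hrmem : ∀ i, 1 ≤ i → i ≤ l → r i ∈ Set.Icc (0 : ℝ) 1) {i₀ : ℕ}
    (hargmax : ∀ i ≤ l, r i < p i → p i < r (i + 1) → i ≠ i₀ → Jfun p r i < Jfun p r i₀)
    (hi₀ : i₀ ≤ l) {i : ℕ} (hi : i ≤ l) (hne : i ≠ i₀) : Jfun p r i < Jfun p r i₀ := by
  have key : ∀ m ≤ l, (∀ k ≤ l, Jfun p r k ≤ Jfun p r m) → m = i₀ := fun m hm hmax => by
    by_contra hmi
    obtain ⟨h1, h2⟩ := lt_and_lt_of_Jfun_le hp hpmono hr0 hrtop hrmem hm hmax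
    exact absurd (hargmax m hm h1 h2 hmi) (hmax i₀ hi₀).not_gt
  obtain ⟨m, hm, hmax⟩ := Finset.exists_max_image (Finset.range (l + 1)) (Jfun p r) ⟨0, by simp⟩
  have hmax' : ∀ k ≤ l, Jfun p r k ≤ Jfun p r m := fun k hk =>
    hmax k (Finset.mem_range.2 (by omega))
  obtain rfl := key m (by simpa [Nat.lt_succ_iff] using hm) hmax'
  by_contra! h
  exact hne (key i hi fun k hk => (hmax' k hk).trans h)

/-- The binomial probability mass function. -/
noncomputable def binomialMass (N : ℕ) (x : ℝ) (j : ℕ) : ℝ :=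
  N.choose j * x ^ j * (1 - x) ^ (N - j)

lemma binomialMass_nonneg {x : ℝ} (h0 : 0 ≤ x) (h1 : x ≤ 1) (N j : ℕ) :
    0 ≤ binomialMass N x j := by
  have : 0 ≤ 1 - x := by linarith
  unfold binomialMass
  positivity

lemma eval_bernsteinPolynomial (N : ℕ) (x : ℝ) (j : ℕ) :
    (bernsteinPolynomial ℝ N j).eval x = binomialMass N x j := by
  simp [bernsteinPolynomial, binomialMass]

lemma sum_binomialMass (N : ℕ) (x : ℝ) :
    ∑ j ∈ Finset.range (N + 1), binomialMass N x j = 1 := by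
  simpa [Polynomial.eval_finsetSum, eval_bernsteinPolynomial] using
    congrArg (Polynomial.eval x) (bernsteinPolynomial.sum ℝ N)

lemma sum_mul_binomialMass (N : ℕ) (x : ℝ) :
    ∑ j ∈ Finset.range (N + 1), (j : ℝ) * binomialMass N x j = N * x := by
  simpa [Polynomial.eval_finsetSum, eval_bernsteinPolynomial] using
    congrArg (Polynomial.eval x) (bernsteinPolynomial.sum_smul ℝ N)

lemma sum_sq_mul_binomialMass (N : ℕ) (x : ℝ) :
    ∑ j ∈ Finset.range (N + 1), (N * x - j) ^ 2 * binomialMass N x j = N * x * (1 - x) := by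
  simpa [Polynomial.eval_finsetSum, eval_bernsteinPolynomial, mul_assoc] using
    congrArg (Polynomial.eval x) (bernsteinPolynomial.variance ℝ N)

lemma sum_binomialMass_le_one {x : ℝ} (h0 : 0 ≤ x) (h1 : x ≤ 1) {N : ℕ} {s : Finset ℕ}
    (hs : s ⊆ Finset.range (N + 1)) : ∑ j ∈ s, binomialMass N x j ≤ 1 :=
  (Finset.sum_le_sum_of_subset_of_nonneg hs fun j _ _ => binomialMass_nonneg h0 h1 N j).trans_eq
    (sum_binomialMass N x)

lemma abs_two_mul_div_sub_one_le {j N : ℕ} (h : j ≤ N) : |2 * (j : ℝ) / N - 1| ≤ 1 := by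
  have h1 : (j : ℝ) / N ≤ 1 := div_le_one_of_le₀ (by exact_mod_cast h) (Nat.cast_nonneg N)
  have h2 : 0 ≤ (j : ℝ) / N := by positivity
  rw [mul_div_assoc, abs_le]
  constructor <;> linarith

lemma abs_sum_mul_binomialMass_le {x : ℝ} (h0 : 0 ≤ x) (h1 : x ≤ 1) {N : ℕ} {s : Finset ℕ}
    (hs : s ⊆ Finset.range (N + 1)) :
    |∑ j ∈ s, (2 * (j : ℝ) / N - 1) * binomialMass N x j| ≤ ∑ j ∈ s, binomialMass N x j := by
  refine (Finset.abs_sum_le_sum_abs _ _).trans (Finset.sum_le_sum fun j hj => ?_)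
  rw [abs_mul, abs_of_nonneg (binomialMass_nonneg h0 h1 N j)]
  exact mul_le_of_le_one_left (binomialMass_nonneg h0 h1 N j)
    (abs_two_mul_div_sub_one_le (by have := Finset.mem_range.1 (hs hj); omega))

/-- Chebyshev's inequality for the binomial distribution. -/
lemma sum_binomialMass_le_of_le_abs {x δ : ℝ} (h0 : 0 ≤ x) (h1 : x ≤ 1) (hδ : 0 < δ) {N : ℕ}
    (hN : 0 < N) {s : Finset ℕ} (hs : s ⊆ Finset.range (N + 1))
    (hdev : ∀ j ∈ s, δ * N ≤ |N * x - j|) :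
    ∑ j ∈ s, binomialMass N x j ≤ x * (1 - x) / δ ^ 2 / N := by
  have hN' : (0 : ℝ) < N := by exact_mod_cast hN
  have h : (δ * N) ^ 2 * ∑ j ∈ s, binomialMass N x j ≤ N * x * (1 - x) := by
    rw [Finset.mul_sum, ← sum_sq_mul_binomialMass]
    refine (Finset.sum_le_sum fun j hj => ?_).trans (Finset.sum_le_sum_of_subset_of_nonneg hs
      fun j _ _ => mul_nonneg (sq_nonneg _) (binomialMass_nonneg h0 h1 N j))
    refine mul_le_mul_of_nonneg_right ?_ (binomialMass_nonneg h0 h1 N j)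
    rw [← sq_abs (N * x - j : ℝ)]
    exact pow_le_pow_left₀ (by positivity) (hdev j hj) 2
  rw [div_div, le_div_iff₀ (by positivity)]
  refine le_of_mul_le_mul_right ?_ hN'
  linarith

/-- Law of large numbers: the binomial mass outside a window `[a N, b N)` with
`lim a N / N < x < lim b N / N` vanishes. -/
lemma tendsto_sum_binomialMass_sdiff {x α β : ℝ} (h0 : 0 ≤ x) (h1 : x ≤ 1) {a b : ℕ → ℕ}
    (ha : Tendsto (fun N => (a N : ℝ) / N) atTop (𝓝 α))
    (hb : Tendsto (fun N => (b N : ℝ) / N) atTop (𝓝 β)) (hα : α < x) (hβ : x < β) :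
    Tendsto (fun N => ∑ j ∈ Finset.range (N + 1) \ Finset.Ico (a N) (b N), binomialMass N x j)
      atTop (𝓝 0) := by
  obtain ⟨α', hα1, hα2⟩ := exists_between hα
  obtain ⟨β', hβ1, hβ2⟩ := exists_between hβ
  set δ := min (x - α') (β' - x) with hδ
  have hδ0 : 0 < δ := lt_min (by linarith) (by linarith)
  refine tendsto_of_tendsto_of_tendsto_of_le_of_le' tendsto_const_nhds
    (tendsto_const_div_atTop_nhds_zero_nat (x * (1 - x) / δ ^ 2))
    (Eventually.of_forall fun N => Finset.sum_nonneg fun j _ => binomialMass_nonneg h0 h1 N j) ?_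
  filter_upwards [ha.eventually_lt_const hα1, hb.eventually_const_lt hβ2,
    eventually_gt_atTop 0] with N hNa hNb hN
  refine sum_binomialMass_le_of_le_abs h0 h1 hδ0 hN Finset.sdiff_subset fun j hj => ?_
  have hN' : (0 : ℝ) < N := by exact_mod_cast hN
  rw [div_lt_iff₀ hN'] at hNa
  rw [lt_div_iff₀ hN'] at hNb
  have hδ1 := mul_le_mul_of_nonneg_right (min_le_left (x - α') (β' - x)) hN'.le
  have hδ2 := mul_le_mul_of_nonneg_right (min_le_right (x - α') (β' - x)) hN'.le
  rw [← hδ] at hδ1 hδ2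
  rw [Finset.mem_sdiff, Finset.mem_Ico, not_and_or, not_le, not_lt] at hj
  rcases hj.2 with hj | hj
  · have : (j : ℝ) < a N := by exact_mod_cast hj
    refine le_trans ?_ (le_abs_self _)
    linarith
  · have : (b N : ℝ) ≤ j := by exact_mod_cast hj
    refine le_trans ?_ (neg_le_abs _)
    linarith

lemma tendsto_sum_binomialMass_Ico {x α β : ℝ} (h0 : 0 ≤ x) (h1 : x ≤ 1) {a b : ℕ → ℕ}
    (ha : Tendsto (fun N => (a N : ℝ) / N) atTop (𝓝 α))
    (hb : Tendsto (fun N => (b N : ℝ) / N) atTop (𝓝 β)) (hα : α < x) (hβ : x < β)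
    (hbN : ∀ᶠ N in atTop, b N ≤ N + 1) :
    Tendsto (fun N => ∑ j ∈ Finset.Ico (a N) (b N), binomialMass N x j) atTop (𝓝 1) := by
  have h := (tendsto_sum_binomialMass_sdiff h0 h1 ha hb hα hβ).const_sub 1
  rw [sub_zero] at h
  refine h.congr' ?_
  filter_upwards [hbN] with N hN
  have hsub : Finset.Ico (a N) (b N) ⊆ Finset.range (N + 1) := fun j hj => by
    rw [Finset.mem_Ico] at hj
    rw [Finset.mem_range]
    omega
  rw [← sum_binomialMass N x, ← Finset.sum_sdiff hsub, add_sub_cancel_left]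

lemma tendsto_sum_mul_binomialMass_Ico {x α β : ℝ} (h0 : 0 ≤ x) (h1 : x ≤ 1) {a b : ℕ → ℕ}
    (ha : Tendsto (fun N => (a N : ℝ) / N) atTop (𝓝 α))
    (hb : Tendsto (fun N => (b N : ℝ) / N) atTop (𝓝 β)) (hα : α < x) (hβ : x < β)
    (hbN : ∀ᶠ N in atTop, b N ≤ N + 1) :
    Tendsto (fun N => ∑ j ∈ Finset.Ico (a N) (b N), (2 * (j : ℝ) / N - 1) * binomialMass N x j)
      atTop (𝓝 (2 * x - 1)) := by
  have h := (squeeze_zero_norm (fun N => abs_sum_mul_binomialMass_le h0 h1 Finset.sdiff_subset)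
    (tendsto_sum_binomialMass_sdiff h0 h1 ha hb hα hβ)).const_sub (2 * x - 1)
  rw [sub_zero] at h
  refine h.congr' ?_
  filter_upwards [hbN, eventually_gt_atTop 0] with N hN hN0
  have hsub : Finset.Ico (a N) (b N) ⊆ Finset.range (N + 1) := fun j hj => by
    rw [Finset.mem_Ico] at hj
    rw [Finset.mem_range]
    omega
  have hmean : ∑ j ∈ Finset.range (N + 1), (2 * (j : ℝ) / N - 1) * binomialMass N x j
      = 2 * x - 1 := by
    have hN' : (N : ℝ) ≠ 0 := by exact_mod_cast hN0.ne'
    calc _ = 2 / N * (∑ j ∈ Finset.range (N + 1), (j : ℝ) * binomialMass N x j)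
          - ∑ j ∈ Finset.range (N + 1), binomialMass N x j := by
          rw [Finset.mul_sum, ← Finset.sum_sub_distrib]
          exact Finset.sum_congr rfl fun j _ => by ring
      _ = 2 * x - 1 := by
          rw [sum_mul_binomialMass, sum_binomialMass]
          field_simp
  rw [← hmean, ← Finset.sum_sdiff hsub, add_sub_cancel_left]

/-- The total weight of stage `i` before restricting a binomial variable to that stage. -/
noncomputable def stageWeight (p : ℕ → ℝ) (N : ℕ) (M : ℕ → ℕ) (i : ℕ) : ℝ :=
  1 / (1 - p i) * (∏ k ∈ Finset.Icc 1 i, (p (k - 1) / (1 - p (k - 1))) ^ (M k - M (k - 1))) /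
    (p i ^ M i * (1 - p i) ^ (N - M i))

lemma stageWeight_pos {p : ℕ → ℝ} {i : ℕ} (hp : ∀ k ≤ i, 0 < p k ∧ p k < 1) (N : ℕ)
    (M : ℕ → ℕ) : 0 < stageWeight p N M i := by
  have h0 := (hp i le_rfl).1
  have h1 : 0 < 1 - p i := by linarith [(hp i le_rfl).2]
  refine div_pos (mul_pos (by positivity) (Finset.prod_pos fun k hk => ?_)) (by positivity)
  rw [Finset.mem_Icc] at hk
  have hk' := hp (k - 1) (by omega)
  exact pow_pos (div_pos hk'.1 (by linarith)) _

lemma log_stageWeight {p : ℕ → ℝ} {i : ℕ} (hp : ∀ k ≤ i, 0 < p k ∧ p k < 1) {N : ℕ}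
    {M : ℕ → ℕ} (hmono : ∀ k ∈ Finset.Icc 1 i, M (k - 1) ≤ M k) (hN : M i ≤ N) :
    Real.log (stageWeight p N M i) =
      -Real.log (1 - p i) - (M i * Real.log (p i) + (N - M i) * Real.log (1 - p i)) +
        ∑ k ∈ Finset.Icc 1 i,
          ((M k : ℝ) - M (k - 1)) * Real.log (p (k - 1) / (1 - p (k - 1))) := by
  have h0 := (hp i le_rfl).1
  have h1 : 0 < 1 - p i := by linarith [(hp i le_rfl).2]
  have hρ : ∀ k ∈ Finset.Icc 1 i, 0 < p (k - 1) / (1 - p (k - 1)) := fun k hk => by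
    rw [Finset.mem_Icc] at hk
    have hk' := hp (k - 1) (by omega)
    exact div_pos hk'.1 (by linarith)
  have hprod := Finset.prod_pos fun k hk => pow_pos (hρ k hk) (M k - M (k - 1))
  unfold stageWeight
  rw [Real.log_div (by positivity) (by positivity), Real.log_mul (by positivity) hprod.ne',
    one_div, Real.log_inv, Real.log_mul (by positivity) (by positivity), Real.log_pow,
    Real.log_pow, Real.log_prod fun k hk => (pow_pos (hρ k hk) _).ne', Nat.cast_sub hN,
    Finset.sum_congr rfl fun k hk => by rw [Real.log_pow, Nat.cast_sub (hmono k hk)]]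
  ring

lemma tendsto_log_stageWeight_div {p r : ℕ → ℝ} {i : ℕ} (hp : ∀ k ≤ i, 0 < p k ∧ p k < 1)
    {M : ℕ → ℕ → ℕ} (hmono : ∀ᶠ N in atTop, ∀ k ∈ Finset.Icc 1 i, M N (k - 1) ≤ M N k)
    (hN : ∀ᶠ N in atTop, M N i ≤ N)
    (hM : ∀ k ≤ i, Tendsto (fun N => (M N k : ℝ) / N) atTop (𝓝 (r k))) :
    Tendsto (fun N : ℕ => Real.log (stageWeight p N (M N) i) / N) atTop
      (𝓝 (Real.log (Jfun p r i))) := by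
  have hsum : Tendsto (fun N : ℕ => ∑ k ∈ Finset.Icc 1 i,
      ((M N k : ℝ) / N - M N (k - 1) / N) * Real.log (p (k - 1) / (1 - p (k - 1)))) atTop
      (𝓝 (∑ k ∈ Finset.Icc 1 i,
        (r k - r (k - 1)) * Real.log (p (k - 1) / (1 - p (k - 1))))) := by
    refine tendsto_finsetSum _ fun k hk => ?_
    rw [Finset.mem_Icc] at hk
    exact ((hM k hk.2).sub (hM (k - 1) (by omega))).mul_const _
  have hlin := (((hM i le_rfl).mul_const (Real.log (p i))).add
    (((hM i le_rfl).const_sub 1).mul_const (Real.log (1 - p i)))).neg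
  have hconst := tendsto_const_div_atTop_nhds_zero_nat (-Real.log (1 - p i))
  have h := (hconst.add hlin).add hsum
  rw [zero_add, ← log_Jfun hp] at h
  refine h.congr' ?_
  filter_upwards [hmono, hN, eventually_gt_atTop 0] with N hmonoN hNN hN0
  have hN' : (N : ℝ) ≠ 0 := by exact_mod_cast hN0.ne'
  rw [log_stageWeight hp hmonoN hNN, add_div, Finset.sum_div]
  congr 1
  · field_simp
    ring
  · exact Finset.sum_congr rfl fun k _ => by ring

lemma tendsto_div_zero_of_log_div_lt {u v : ℕ → ℝ} {a b : ℝ} (hu : ∀ N, 0 < u N)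
    (hv : ∀ N, 0 < v N) (ha : Tendsto (fun N : ℕ => Real.log (u N) / N) atTop (𝓝 a))
    (hb : Tendsto (fun N : ℕ => Real.log (v N) / N) atTop (𝓝 b)) (hab : a < b) :
    Tendsto (fun N => u N / v N) atTop (𝓝 0) := by
  have h := (ha.sub hb).neg_mul_atTop (sub_neg.2 hab) tendsto_natCast_atTop_atTop
  refine (Real.tendsto_exp_atBot.comp h).congr' ?_
  filter_upwards [eventually_gt_atTop 0] with N hN0
  have hN' : (N : ℝ) ≠ 0 := by exact_mod_cast hN0.ne'
  rw [Function.comp_apply, ← sub_div, div_mul_cancel₀ _ hN', Real.exp_sub, Real.exp_log (hu N),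
    Real.exp_log (hv N)]

lemma choose_mul_pow_eq {x : ℝ} (h0 : 0 < x) (h1 : x < 1) {N m j : ℕ} (hmj : m ≤ j)
    (hjN : j ≤ N) : (N.choose j : ℝ) * (x / (1 - x)) ^ (j - m) =
      binomialMass N x j / (x ^ m * (1 - x) ^ (N - m)) := by
  have h1' : 0 < 1 - x := by linarith
  obtain ⟨d, rfl⟩ := Nat.exists_eq_add_of_le hmj
  obtain ⟨e, rfl⟩ := Nat.exists_eq_add_of_le hjN
  have e1 : m + d - m = d := by omega
  have e2 : m + d + e - (m + d) = e := by omega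
  have e3 : m + d + e - m = d + e := by omega
  unfold binomialMass
  rw [e1, e2, e3, div_pow, pow_add, pow_add]
  field_simp

lemma speedMulti_eq {N l : ℕ} {M : ℕ → ℕ} {p : ℕ → ℝ} (hp : ∀ k ≤ l, 0 < p k ∧ p k < 1)
    (hM : ∀ i ≤ l, M (i + 1) ≤ N + 1) :
    speedMulti N l M p =
      (∑ i ∈ Finset.range (l + 1), stageWeight p N M i *
        ∑ j ∈ Finset.Ico (M i) (M (i + 1)), (2 * (j : ℝ) / N - 1) * binomialMass N (p i) j) /
      (∑ i ∈ Finset.range (l + 1), stageWeight p N M i *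
        ∑ j ∈ Finset.Ico (M i) (M (i + 1)), binomialMass N (p i) j) := by
  unfold speedMulti stageWeight
  congr 1 <;> refine Finset.sum_congr rfl fun i hi => ?_ <;>
    rw [div_mul_eq_mul_div _ (p i ^ M i * (1 - p i) ^ (N - M i)),
      mul_div_assoc _ _ (p i ^ M i * (1 - p i) ^ (N - M i)), Finset.sum_div] <;> congr 1 <;>
    refine Finset.sum_congr rfl fun j hj => ?_ <;> rw [Finset.mem_Ico] at hj <;>
    rw [Finset.mem_range, Nat.lt_succ_iff] at hi <;> have hMi := hM i hi
  · rw [mul_assoc, choose_mul_pow_eq (hp i hi).1 (hp i hi).2 hj.1 (by omega),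
      ← mul_div_assoc _ (binomialMass _ _ _)]
  · exact choose_mul_pow_eq (hp i hi).1 (hp i hi).2 hj.1 (by omega)

/-- A bounded-coefficient sum whose weights, relative to the weight at `i₀`, vanish away from
`i₀` is asymptotic to its term at `i₀`. -/
lemma tendsto_sum_mul_div {s : Finset ℕ} {i₀ : ℕ} (hi₀ : i₀ ∈ s) {w c : ℕ → ℕ → ℝ} {L : ℝ}
    (hw : ∀ N, w N i₀ ≠ 0)
    (hw0 : ∀ i ∈ s, i ≠ i₀ → Tendsto (fun N => w N i / w N i₀) atTop (𝓝 0))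
    (hc : ∀ i ∈ s, ∀ᶠ N in atTop, |c N i| ≤ 1) (hL : Tendsto (fun N => c N i₀) atTop (𝓝 L)) :
    Tendsto (fun N => (∑ i ∈ s, w N i * c N i) / w N i₀) atTop (𝓝 L) := by
  have h : Tendsto (fun N => ∑ i ∈ s, w N i / w N i₀ * c N i) atTop
      (𝓝 (∑ i ∈ s, if i = i₀ then L else 0)) := by
    refine tendsto_finsetSum _ fun i hi => ?_
    split_ifs with hii
    · subst hii
      simpa [div_self (hw _)] using hL
    · refine squeeze_zero_norm' ?_ (by simpa using (hw0 i hi hii).abs)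
      filter_upwards [hc i hi] with N hN
      rw [Real.norm_eq_abs, abs_mul]
      exact mul_le_of_le_one_right (abs_nonneg _) hN
  rw [Finset.sum_ite_eq' s i₀, if_pos hi₀] at h
  refine h.congr fun N => ?_
  rw [Finset.sum_div]
  exact Finset.sum_congr rfl fun i _ => by ring

/-- Theorem 1.4(i): if the maximum of `J_i` over the indices `i` with
`r_i < p_i < r_{i+1}` is attained at the unique index `i₀`, then the multi-stage
speed converges to `2 p_{i₀} - 1` as `N → ∞` with `M_i/N → r_i`. -/
theorem limit_speed_multistage_unique_argmax (l : ℕ) (hl : 1 ≤ l)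
    (p : ℕ → ℝ) (hp0 : 0 < p 0) (hpmono : ∀ i < l, p i < p (i + 1)) (hpl : p l < 1)
    (r : ℕ → ℝ) (hr0 : r 0 = 0) (hrtop : r (l + 1) = 1)
    (hrmem : ∀ i, 1 ≤ i → i ≤ l → r i ∈ Set.Icc (0 : ℝ) 1)
    (hrmono : ∀ i, 1 ≤ i → i < l → r i ≤ r (i + 1))
    (i0 : ℕ) (hi0l : i0 ≤ l) (hi0lo : r i0 < p i0) (hi0hi : p i0 < r (i0 + 1))
    (hargmax : ∀ i ≤ l, r i < p i → p i < r (i + 1) → i ≠ i0 →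
      Jfun p r i < Jfun p r i0)
    (M : ℕ → ℕ → ℕ)
    (hMvalid : ∀ N, l ≤ N → 1 ≤ M N 1 ∧
      (∀ i, 1 ≤ i → i < l → M N i < M N (i + 1)) ∧ M N l ≤ N)
    (hM0 : ∀ N, M N 0 = 0) (hMtop : ∀ N, M N (l + 1) = N + 1)
    (hMconv : ∀ i, 1 ≤ i → i ≤ l →
      Tendsto (fun N => (M N i : ℝ) / N) atTop (𝓝 (r i))) :
    Tendsto (fun N => speedMulti N l (M N) p) atTop (𝓝 (2 * p i0 - 1)) := by
  have hp : ∀ k ≤ l, 0 < p k ∧ p k < 1 := by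
    have hpos : ∀ k ≤ l, 0 < p k := fun k hk => by
      induction k with
      | zero => exact hp0
      | succ k ih => exact (ih (by omega)).trans (hpmono k hk)
    refine fun k hk => ⟨hpos k hk, ?_⟩
    induction hk using Nat.decreasingInduction with
    | self => exact hpl
    | of_succ k hk ih => exact (hpmono k hk).trans ih
  have hJ : ∀ i ≤ l, i ≠ i0 → Jfun p r i < Jfun p r i0 := fun i hi hne =>
    Jfun_lt_of_ne hp hpmono hr0 hrtop hrmem hargmax hi0l hi hne
  have hmono : ∀ N, l ≤ N → ∀ i ≤ l, M N i ≤ M N (i + 1) := fun N hN i hi => by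
    obtain ⟨-, h2, h3⟩ := hMvalid N hN
    rcases Nat.eq_zero_or_pos i with rfl | hi1
    · simp [hM0]
    · rcases hi.eq_or_lt with rfl | hil
      · rw [hMtop]
        omega
      · exact (h2 i hi1 hil).le
  have hle : ∀ N, l ≤ N → ∀ i ≤ l, M N i ≤ N := fun N hN i hi => by
    induction hi using Nat.decreasingInduction with
    | self => exact (hMvalid N hN).2.2
    | of_succ k hk ih => exact (hmono N hN k hk.le).trans ih
  have hle' : ∀ N, l ≤ N → ∀ i ≤ l, M N (i + 1) ≤ N + 1 := fun N hN i hi => by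
    rcases hi.eq_or_lt with rfl | hil
    · rw [hMtop]
    · exact (hle N hN (i + 1) hil).trans (Nat.le_succ N)
  have hconv : ∀ i ≤ l + 1, Tendsto (fun N => (M N i : ℝ) / N) atTop (𝓝 (r i)) := fun i hi => by
    rcases Nat.eq_zero_or_pos i with rfl | hi1
    · simp [hM0, hr0]
    · rcases hi.eq_or_lt with rfl | hil
      · rw [hrtop]
        have h := (tendsto_const_div_atTop_nhds_zero_nat (1 : ℝ)).const_add 1
        rw [add_zero] at h
        refine h.congr' ?_
        filter_upwards [eventually_gt_atTop 0] with N hN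
        have hN' : (N : ℝ) ≠ 0 := by exact_mod_cast hN.ne'
        rw [hMtop]
        push_cast
        field_simp
      · exact hMconv i hi1 (by omega)
  have hwpos : ∀ i ≤ l, ∀ N, 0 < stageWeight p N (M N) i := fun i hi N =>
    stageWeight_pos (fun k hk => hp k (hk.trans hi)) N (M N)
  have hlog : ∀ i ≤ l, Tendsto (fun N : ℕ => Real.log (stageWeight p N (M N) i) / N) atTop
      (𝓝 (Real.log (Jfun p r i))) := fun i hi => by
    refine tendsto_log_stageWeight_div (fun k hk => hp k (hk.trans hi)) ?_ ?_
      fun k hk => hconv k (by omega)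
    · filter_upwards [eventually_ge_atTop l] with N hN k hk
      rw [Finset.mem_Icc] at hk
      have h := hmono N hN (k - 1) (by omega)
      rwa [Nat.sub_add_cancel hk.1] at h
    · filter_upwards [eventually_ge_atTop l] with N hN using hle N hN i hi
  have hratio : ∀ i ∈ Finset.range (l + 1), i ≠ i0 → Tendsto
      (fun N => stageWeight p N (M N) i / stageWeight p N (M N) i0) atTop (𝓝 0) :=
    fun i hi hne => by
    have hi' : i ≤ l := Nat.lt_succ_iff.1 (Finset.mem_range.1 hi)
    exact tendsto_div_zero_of_log_div_lt (hwpos i hi') (hwpos i0 hi0l) (hlog i hi')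
      (hlog i0 hi0l) (Real.log_lt_log (Jfun_pos fun k hk => hp k (hk.trans hi')) (hJ i hi' hne))
  have hsub : ∀ N, l ≤ N → ∀ i ≤ l,
      Finset.Ico (M N i) (M N (i + 1)) ⊆ Finset.range (N + 1) := fun N hN i hi j hj => by
    rw [Finset.mem_Ico] at hj
    exact Finset.mem_range.2 (hj.2.trans_le (hle' N hN i hi))
  have hbN : ∀ᶠ N in atTop, M N (i0 + 1) ≤ N + 1 := by
    filter_upwards [eventually_ge_atTop l] with N hN using hle' N hN i0 hi0l
  have hi0mem : i0 ∈ Finset.range (l + 1) := Finset.mem_range.2 (Nat.lt_succ_iff.2 hi0l)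
  have hp0' := (hp i0 hi0l).1.le
  have hp1' := (hp i0 hi0l).2.le
  have hnum := tendsto_sum_mul_div (w := fun N i => stageWeight p N (M N) i)
    (c := fun N i => ∑ j ∈ Finset.Ico (M N i) (M N (i + 1)),
      (2 * (j : ℝ) / N - 1) * binomialMass N (p i) j) hi0mem
    (fun N => (hwpos i0 hi0l N).ne') hratio
    (fun i hi => by
      have hi' : i ≤ l := Nat.lt_succ_iff.1 (Finset.mem_range.1 hi)
      filter_upwards [eventually_ge_atTop l] with N hN
      exact (abs_sum_mul_binomialMass_le (hp i hi').1.le (hp i hi').2.le (hsub N hN i hi')).trans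
        (sum_binomialMass_le_one (hp i hi').1.le (hp i hi').2.le (hsub N hN i hi')))
    (tendsto_sum_mul_binomialMass_Ico hp0' hp1' (hconv i0 (by omega))
      (hconv (i0 + 1) (by omega)) hi0lo hi0hi hbN)
  have hden := tendsto_sum_mul_div (w := fun N i => stageWeight p N (M N) i)
    (c := fun N i => ∑ j ∈ Finset.Ico (M N i) (M N (i + 1)), binomialMass N (p i) j) hi0mem
    (fun N => (hwpos i0 hi0l N).ne') hratio
    (fun i hi => by
      have hi' : i ≤ l := Nat.lt_succ_iff.1 (Finset.mem_range.1 hi)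
      filter_upwards [eventually_ge_atTop l] with N hN
      rw [abs_of_nonneg (Finset.sum_nonneg fun j _ =>
        binomialMass_nonneg (hp i hi').1.le (hp i hi').2.le N j)]
      exact sum_binomialMass_le_one (hp i hi').1.le (hp i hi').2.le (hsub N hN i hi'))
    (tendsto_sum_binomialMass_Ico hp0' hp1' (hconv i0 (by omega))
      (hconv (i0 + 1) (by omega)) hi0lo hi0hi hbN)
  have h := hnum.div hden one_ne_zero
  rw [div_one] at h
  refine h.congr' ?_
  filter_upwards [eventually_ge_atTop l] with N hN
  rw [speedMulti_eq hp (hle' N hN), Pi.div_apply,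
    div_div_div_cancel_right₀ (hwpos i0 hi0l N).ne']
end
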